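/- For each n ≥ 1 let m_n denote the number of pairs (F, M) where F is an acyclic simple graph (forest) on the vertex set Fin n and M is a maximal matching of F, and let f_n denote the number of acyclic simple graphs on Fin n. Then there exist real constants D > 0 and β > 1 such that the sequence (m_n / f_n) / β^n converges to D as n → ∞. In other words, the average number of maximal matchings of a uniformly random forest on n vertices grows like D·β^n with β > 1. -/

import Mathlib

open Filter Topology MeasureTheory

/-- `M` is a matching of `G`: a set of edges of `G`, no two distinct
edges of which share a vertex. -/
def IsMatching {V : Type*} (G : SimpleGraph V) (M : Set (Sym2 V)) : Prop :=
  M ⊆ G.edgeSet ∧ ∀ e ∈ M, ∀ f ∈ M, e ≠ f → ∀ v : V, v ∈ e → v ∉ f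

/-- `M` is a maximal matching of `G`. -/
def IsMaximalMatching {V : Type*} (G : SimpleGraph V) (M : Set (Sym2 V)) : Prop :=
  IsMatching G M ∧ ∀ M' : Set (Sym2 V), IsMatching G M' → ¬ M ⊂ M'

/-- The pairs `(F, M)` where `F` is a forest (acyclic simple graph) on `Fin n`
and `M` is a maximal matching of `F`. -/
def MMSpace (n : ℕ) :=
  {p : SimpleGraph (Fin n) × Set (Sym2 (Fin n)) // p.1.IsAcyclic ∧ IsMaximalMatching p.1 p.2}

/-- `mN n` is the number of pairs `(F, M)` where `F` is a forest on `Fin n`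
and `M` is a maximal matching of `F`. -/
noncomputable def mN (n : ℕ) : ℕ := Nat.card (MMSpace n)

/-- `fN n` is the number of forests (acyclic simple graphs) on `Fin n`. -/
noncomputable def fN (n : ℕ) : ℕ := Nat.card {G : SimpleGraph (Fin n) // G.IsAcyclic}

/-- The `m`-th Taylor coefficient at `0` of an entire function, as a Cauchy integral over the
circle of radius `s`. -/
noncomputable def cauchyCoeff (s : ℝ) (m : ℕ) (g : ℂ → ℂ) : ℂ :=
  (2 * Real.pi * Complex.I)⁻¹ * ∮ z in C(0, s), g z / z ^ (m + 1)

section CauchyCoeff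

variable {s : ℝ} (hs : 0 < s)

include hs

theorem ne_zero_of_mem_sphere_zero {z : ℂ} (hz : z ∈ Metric.sphere (0 : ℂ) s) : z ≠ 0 := by
  rintro rfl
  simp at hz
  exact hs.ne hz

theorem continuousOn_div_pow {g : ℂ → ℂ} (hg : Continuous g) (m : ℕ) :
    ContinuousOn (fun z => g z / z ^ m) (Metric.sphere (0 : ℂ) s) :=
  hg.continuousOn.div (by fun_prop) fun _ hz => pow_ne_zero _ (ne_zero_of_mem_sphere_zero hs hz)

theorem cauchyCoeff_zero {g : ℂ → ℂ} (hg : Differentiable ℂ g) : cauchyCoeff s 0 g = g 0 := by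
  have h := (hg.diffContOnCl (s := Metric.ball (0 : ℂ) s)).two_pi_i_inv_smul_circleIntegral_sub_inv_smul
    (Metric.mem_ball_self hs)
  rw [← h, cauchyCoeff, smul_eq_mul]
  congr 1
  apply circleIntegral.integral_congr hs.le
  intro z _
  simp [div_eq_inv_mul]

theorem cauchyCoeff_succ_X_mul (m : ℕ) (g : ℂ → ℂ) :
    cauchyCoeff s (m + 1) (fun z => z * g z) = cauchyCoeff s m g := by
  unfold cauchyCoeff
  congr 1
  apply circleIntegral.integral_congr hs.le
  intro z hz
  have := ne_zero_of_mem_sphere_zero hs hz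
  simp only
  field_simp
  ring

theorem cauchyCoeff_X_pow_mul (m j : ℕ) {g : ℂ → ℂ} (hg : Differentiable ℂ g) :
    cauchyCoeff s m (fun z => z ^ j * g z) = if j ≤ m then cauchyCoeff s (m - j) g else 0 := by
  induction j generalizing m with
  | zero => simp
  | succ j ih =>
    have e : (fun z : ℂ => z ^ (j + 1) * g z) = fun z => z * (z ^ j * g z) := by
      funext z; ring
    rw [e]
    cases m with
    | zero => rw [cauchyCoeff_zero hs (by fun_prop)]; simp
    | succ m => rw [cauchyCoeff_succ_X_mul hs, ih]; simp

theorem cauchyCoeff_add (m : ℕ) {f g : ℂ → ℂ} (hf : Continuous f) (hg : Continuous g) :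
    cauchyCoeff s m (fun z => f z + g z) = cauchyCoeff s m f + cauchyCoeff s m g := by
  unfold cauchyCoeff
  rw [← mul_add, ← circleIntegral.integral_add
    ((continuousOn_div_pow hs hf _).circleIntegrable hs.le)
    ((continuousOn_div_pow hs hg _).circleIntegrable hs.le)]
  simp only [add_div]

omit hs in
theorem cauchyCoeff_const_mul (m : ℕ) (a : ℂ) (g : ℂ → ℂ) :
    cauchyCoeff s m (fun z => a * g z) = a * cauchyCoeff s m g := by
  unfold cauchyCoeff
  simp only [mul_div_assoc, circleIntegral.integral_const_mul]
  ring

theorem cauchyCoeff_sum (m : ℕ) {ι : Type*} (t : Finset ι) {f : ι → ℂ → ℂ}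
    (hf : ∀ i ∈ t, Continuous (f i)) :
    cauchyCoeff s m (fun z => ∑ i ∈ t, f i z) = ∑ i ∈ t, cauchyCoeff s m (f i) := by
  unfold cauchyCoeff
  rw [← Finset.mul_sum, ← circleIntegral.integral_fun_sum
    fun i hi => (continuousOn_div_pow hs (hf i hi) _).circleIntegrable hs.le]
  simp only [Finset.sum_div]

theorem cauchyCoeff_deriv (m : ℕ) {g g' : ℂ → ℂ} (hg : ∀ z, HasDerivAt g (g' z) z)
    (hg' : Continuous g') :
    cauchyCoeff s m g' = (m + 1) * cauchyCoeff s (m + 1) g := by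
  have hgc : Continuous g := continuous_iff_continuousAt.2 fun z => (hg z).continuousAt
  have key : (∮ z in C(0, s), (g' z / z ^ (m + 1) - (m + 1) * (g z / z ^ (m + 1 + 1)))) = 0 := by
    apply circleIntegral.integral_eq_zero_of_hasDerivWithinAt (f := fun z => g z / z ^ (m + 1)) hs.le
    intro z hz
    have hz := ne_zero_of_mem_sphere_zero hs hz
    have := ((hg z).div (hasDerivAt_pow (m + 1) z) (pow_ne_zero _ hz)).hasDerivWithinAt
      (s := Metric.sphere 0 s)
    refine this.congr_deriv ?_
    rw [Nat.add_sub_cancel]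
    push_cast
    field_simp
    ring
  have h_integral : CircleIntegrable (fun z => (m + 1) * (g z / z ^ (m + 1 + 1))) 0 s :=
    ((continuousOn_div_pow hs hgc _).const_smul (m + 1 : ℂ)).circleIntegrable hs.le
  rw [circleIntegral.integral_sub ((continuousOn_div_pow hs hg' _).circleIntegrable hs.le) h_integral,
    circleIntegral.integral_const_mul, sub_eq_zero] at key
  unfold cauchyCoeff
  rw [key]
  ring

theorem cauchyCoeff_mul_exp (m : ℕ) {A P : ℂ → ℂ} (hA : Differentiable ℂ A)
    (hP : Differentiable ℂ P) :
    cauchyCoeff s m (fun z => A z * Complex.exp (z * P z)) =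
      ∑ l ∈ Finset.range (m + 1),
        cauchyCoeff s (m - l) (fun z => A z * P z ^ l) / (l.factorial : ℂ) := by
  have hAc := hA.continuous
  have hPc := hP.continuous
  have partial_sum : ∀ N, m + 1 ≤ N → cauchyCoeff s m
      (fun z => ∑ l ∈ Finset.range N, A z * ((z * P z) ^ l / (l.factorial : ℂ))) =
      ∑ l ∈ Finset.range (m + 1),
        cauchyCoeff s (m - l) (fun z => A z * P z ^ l) / (l.factorial : ℂ) := by
    intro N hN
    rw [cauchyCoeff_sum hs m _ (fun i _ => by fun_prop)]
    have step : ∀ l, cauchyCoeff s m (fun z => A z * ((z * P z) ^ l / (l.factorial : ℂ))) =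
        if l ≤ m then cauchyCoeff s (m - l) (fun z => A z * P z ^ l) / (l.factorial : ℂ) else 0 := by
      intro l
      have e : (fun z => A z * ((z * P z) ^ l / (l.factorial : ℂ))) =
          fun z => z ^ l * ((l.factorial : ℂ)⁻¹ * (A z * P z ^ l)) := by
        funext z; ring
      rw [e, cauchyCoeff_X_pow_mul hs _ _ (by fun_prop), cauchyCoeff_const_mul]
      simp only [div_eq_inv_mul]
    simp only [step]
    rw [← Finset.sum_filter]
    apply Finset.sum_congr _ fun _ _ => rfl
    ext l
    simp
    lia
  have lim : Tendsto (fun N => cauchyCoeff s m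
      (fun z => ∑ l ∈ Finset.range N, A z * ((z * P z) ^ l / (l.factorial : ℂ)))) atTop
      (𝓝 (cauchyCoeff s m (fun z => A z * Complex.exp (z * P z)))) := by
    unfold cauchyCoeff
    refine Tendsto.const_mul _ ?_
    have hcpt : IsCompact (Metric.sphere (0 : ℂ) s) := isCompact_sphere _ _
    obtain ⟨B, hB⟩ := hcpt.exists_bound_of_continuousOn
      (f := fun z => z * P z) (by fun_prop)
    obtain ⟨C, hC⟩ := hcpt.exists_bound_of_continuousOn
      (continuousOn_div_pow hs hAc (m + 1))
    have hB0 : 0 ≤ B := (norm_nonneg _).trans (hB (s : ℂ) (by simp [abs_of_pos hs]))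
    have hC0 : 0 ≤ C := (norm_nonneg _).trans (hC (s : ℂ) (by simp [abs_of_pos hs]))
    apply TendstoUniformlyOn.tendsto_circleIntegral_of_continuousOn hs.le
    · refine Eventually.of_forall fun N => continuousOn_div_pow hs (by fun_prop) _
    · rw [Metric.tendstoUniformlyOn_iff]
      intro ε hε
      have t0 : Tendsto (fun N : ℕ => C * (B ^ N / (N.factorial : ℝ) * 2)) atTop (𝓝 0) := by
        simpa using ((FloorSemiring.tendsto_pow_div_factorial_atTop B).mul_const 2).const_mul C
      have t1 : ∀ᶠ N : ℕ in atTop, B / (N.succ : ℝ) ≤ 1 / 2 := by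
        filter_upwards [eventually_ge_atTop (⌈2 * B⌉₊)] with N hN
        have h2 : 2 * B ≤ N := (Nat.le_ceil _).trans (by exact_mod_cast hN)
        have : (0 : ℝ) < (N.succ : ℝ) := by positivity
        rw [div_le_iff₀ this]
        push_cast
        linarith
      filter_upwards [t0.eventually (gt_mem_nhds hε), t1] with N hN h1 z hz
      have hz0 := ne_zero_of_mem_sphere_zero hs hz
      rw [dist_eq_norm]
      have e : A z * Complex.exp (z * P z) / z ^ (m + 1) -
          (∑ l ∈ Finset.range N, A z * ((z * P z) ^ l / (l.factorial : ℂ))) / z ^ (m + 1) =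
          (A z / z ^ (m + 1)) * (Complex.exp (z * P z) -
            ∑ l ∈ Finset.range N, (z * P z) ^ l / (l.factorial : ℂ)) := by
        rw [← Finset.mul_sum]; ring
      rw [e, norm_mul]
      refine lt_of_le_of_lt ?_ hN
      have h3 := Complex.exp_bound' (x := z * P z) (n := N)
        ((div_le_div_of_nonneg_right (hB z hz) (by positivity)).trans h1)
      refine mul_le_mul (hC z hz) (h3.trans ?_) (norm_nonneg _) hC0
      have := hB z hz
      gcongr
  refine tendsto_nhds_unique (lim.congr' ?_) tendsto_const_nhds |>.symm ▸ rfl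
  filter_upwards [eventually_ge_atTop (m + 1)] with N hN using partial_sum N hN

end CauchyCoeff

/-- Second-order expansion of an entire function at a double zero. -/
theorem exists_continuousAt_eq_sq_mul {L : ℂ → ℂ} (hL : Differentiable ℂ L) (h0 : L 0 = 0)
    (h1 : deriv L 0 = 0) : ∃ k : ℂ → ℂ, ContinuousAt k 0 ∧ ∀ w, L w = w ^ 2 * k w := by
  have d1 : DifferentiableOn ℂ (dslope L 0) Set.univ :=
    (Complex.differentiableOn_dslope univ_mem).2 hL.differentiableOn
  have d2 : DifferentiableOn ℂ (dslope (dslope L 0) 0) Set.univ :=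
    (Complex.differentiableOn_dslope univ_mem).2 d1
  refine ⟨dslope (dslope L 0) 0, (d2.differentiableAt univ_mem).continuousAt, fun w => ?_⟩
  have e1 := sub_smul_dslope L 0 w
  have e2 := sub_smul_dslope (dslope L 0) 0 w
  rw [dslope_same, h1] at e2
  simp only [sub_zero, smul_eq_mul, h0] at e1 e2
  rw [← e1, ← e2]
  ring

/-- The saddle-point (Laplace) asymptotics of large powers `exp (n q)` at a saddle `s`. -/
theorem tendsto_cauchyCoeff_mul_exp {s : ℝ} (hs : 0 < s) {q B : ℂ → ℂ} (hq : Differentiable ℂ q)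
    (hB : Differentiable ℂ B) (hsaddle : s * deriv q s = 1) (hBs : B s ≠ 0) {c : ℝ} (hc : 0 < c)
    (hdecay : ∀ θ : ℝ, |θ| ≤ Real.pi →
      (q (s * Complex.exp (θ * Complex.I))).re - (q s).re ≤ -c * θ ^ 2) :
    ∃ C : ℂ, C ≠ 0 ∧ Tendsto (fun n : ℕ => (√(n : ℝ) : ℂ) * ((s * Complex.exp (-q s)) ^ n *
      cauchyCoeff s (n - 1) (fun z => B z * Complex.exp (n * q z)))) atTop (𝓝 C) := by
  have hsC : (s : ℂ) ≠ 0 := by exact_mod_cast hs.ne'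
  set L : ℂ → ℂ := fun w => q (s * Complex.exp (w * Complex.I)) - q s - w * Complex.I with hLdef
  have hLd : Differentiable ℂ L := by
    intro w
    have : DifferentiableAt ℂ q (s * Complex.exp (w * Complex.I)) := hq _
    simp only [hLdef]
    fun_prop
  have hL0 : L 0 = 0 := by simp [hLdef]
  have hL1 : deriv L 0 = 0 := by
    have e1 : HasDerivAt (fun w : ℂ => (s : ℂ) * Complex.exp (w * Complex.I)) (s * Complex.I) 0 := by
      have := (((hasDerivAt_id (0 : ℂ)).mul_const Complex.I).cexp).const_mul (s : ℂ)
      simpa using this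
    have e2 : HasDerivAt q (deriv q s) ((s : ℂ) * Complex.exp (0 * Complex.I)) := by
      simpa using (hq s).hasDerivAt
    have e3 := ((e2.comp (0 : ℂ) e1).sub_const (q s)).sub ((hasDerivAt_id (0 : ℂ)).mul_const Complex.I)
    rw [show deriv L 0 = _ from e3.deriv]
    linear_combination Complex.I * hsaddle
  obtain ⟨k, hk, hLk⟩ := exists_continuousAt_eq_sq_mul hLd hL0 hL1
  have hLre : ∀ θ : ℝ, |θ| ≤ Real.pi → (L θ).re ≤ -c * θ ^ 2 := by
    intro θ hθ
    simpa [hLdef] using hdecay θ hθ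
  have hk0 : (k 0).re ≤ -c := by
    have t : Tendsto (fun θ : ℝ => (k θ).re) (𝓝[>] 0) (𝓝 (k 0).re) := by
      have h2 : ContinuousAt (fun θ : ℝ => (k θ).re) 0 := by
        refine Complex.continuous_re.continuousAt.comp (ContinuousAt.comp ?_ ?_)
        · simpa using hk
        · exact Complex.continuous_ofReal.continuousAt
      simpa [ContinuousAt] using h2.tendsto.mono_left nhdsWithin_le_nhds
    refine le_of_tendsto t ?_
    filter_upwards [Ioc_mem_nhdsGT Real.pi_pos] with θ hθ
    have h3 := hLre θ (by rw [abs_of_pos hθ.1]; exact hθ.2)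
    rw [hLk, ← Complex.ofReal_pow, Complex.re_ofReal_mul] at h3
    have : 0 < θ ^ 2 := by have := hθ.1; positivity
    nlinarith
  set b : ℝ → ℂ := fun θ => circleMap 0 s θ * B (circleMap 0 s θ) with hbdef
  have hbc : Continuous b := by
    have := hB.continuous
    simp only [hbdef]
    fun_prop
  set F : ℕ → ℝ → ℂ := fun n θ => b θ * Complex.exp (n * L θ) with hFdef
  have hFc : ∀ n, Continuous (F n) := by
    intro n
    have := hLd.continuous
    simp only [hFdef]
    fun_prop
  obtain ⟨Cb, hCb⟩ := (isCompact_Icc (a := -Real.pi) (b := Real.pi)).exists_bound_of_continuousOn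
    hbc.continuousOn
  have hgauss : (∫ x : ℝ, Complex.exp (k 0 * x ^ 2)) = (Real.pi / (-k 0)) ^ (1 / 2 : ℂ) := by
    have := integral_gaussian_complex (b := -k 0) (by simp; linarith)
    simpa using this
  have hk0' : k 0 ≠ 0 := by
    intro h
    rw [h] at hk0
    simp at hk0
    linarith
  refine ⟨(2 * Real.pi)⁻¹ * ∫ x : ℝ, s * B s * Complex.exp (k 0 * x ^ 2), ?_, ?_⟩
  · rw [integral_const_mul, hgauss]
    have hpi : (Real.pi : ℂ) ≠ 0 := by exact_mod_cast Real.pi_ne_zero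
    refine mul_ne_zero (by simp [hpi]) (mul_ne_zero (mul_ne_zero hsC hBs) ?_)
    rw [Complex.cpow_ne_zero_iff]
    left
    exact div_ne_zero hpi (neg_ne_zero.2 hk0')
  · have h_integral : ∀ n : ℕ, 1 ≤ n → (√(n : ℝ) : ℂ) * ((s * Complex.exp (-q s)) ^ n *
        cauchyCoeff s (n - 1) (fun z => B z * Complex.exp (n * q z))) = (2 * Real.pi)⁻¹ *
        ∫ x : ℝ, (Set.Ioc (-Real.pi) Real.pi).indicator (F n) (x / √(n : ℝ)) := by
      intro n hn
      have hcs := Measure.integral_comp_div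
        ((Set.Ioc (-Real.pi) Real.pi).indicator (F n)) √(n : ℝ)
      rw [hcs, abs_of_nonneg (Real.sqrt_nonneg _), integral_indicator measurableSet_Ioc,
        ← intervalIntegral.integral_of_le (by linarith [Real.pi_pos])]
      have hFp : Function.Periodic (F n) (2 * Real.pi) := by
        intro θ
        simp only [hFdef, hbdef, hLdef, periodic_circleMap 0 s θ]
        congr 1
        have e1 : Complex.exp (((θ + 2 * Real.pi : ℝ) : ℂ) * Complex.I) =
            Complex.exp (θ * Complex.I) := by
          push_cast
          rw [add_mul, Complex.exp_add, Complex.exp_two_pi_mul_I, mul_one]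
        rw [e1, Complex.exp_eq_exp_iff_exists_int]
        refine ⟨-n, ?_⟩
        push_cast
        ring
      have hshift := hFp.intervalIntegral_add_eq (-Real.pi) 0
      rw [show -Real.pi + 2 * Real.pi = Real.pi by ring, zero_add] at hshift
      rw [hshift]
      unfold cauchyCoeff circleIntegral
      have hcongr : ∀ θ : ℝ, deriv (circleMap 0 s) θ • (B (circleMap 0 s θ) *
          Complex.exp (n * q (circleMap 0 s θ)) / circleMap 0 s θ ^ (n - 1 + 1)) =
          (Complex.I * (s * Complex.exp (-q s))⁻¹ ^ n) * F n θ := by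
        intro θ
        rw [Nat.sub_add_cancel hn, deriv_circleMap]
        simp only [hFdef, hbdef, hLdef, smul_eq_mul]
        have e2 : circleMap 0 s θ = s * Complex.exp (θ * Complex.I) := by simp [circleMap]
        rw [e2, mul_sub, mul_sub, Complex.exp_sub, Complex.exp_sub]
        simp only [Complex.exp_nat_mul, mul_pow, mul_inv, inv_pow, Complex.exp_neg]
        have := Complex.exp_ne_zero (q s)
        have := Complex.exp_ne_zero (θ * Complex.I)
        field_simp
      simp only [hcongr]
      rw [intervalIntegral.integral_const_mul, Complex.real_smul, inv_pow]
      have := Complex.exp_ne_zero (-q s)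
      have hne : (s * Complex.exp (-q s)) ^ n ≠ 0 := pow_ne_zero _ (mul_ne_zero hsC this)
      have hpi : (Real.pi : ℂ) ≠ 0 := by exact_mod_cast Real.pi_ne_zero
      push_cast
      field_simp
    have hlim : Tendsto (fun n : ℕ => ∫ x : ℝ, (Set.Ioc (-Real.pi) Real.pi).indicator (F n)
        (x / √(n : ℝ))) atTop (𝓝 (∫ x : ℝ, s * B s * Complex.exp (k 0 * x ^ 2))) := by
      refine tendsto_integral_filter_of_dominated_convergence
        (fun x => Cb * Real.exp (-c * x ^ 2)) ?_ ?_ ?_ ?_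
      · refine Eventually.of_forall fun n => ?_
        have : Measurable fun x : ℝ => x / √(n : ℝ) := by fun_prop
        exact (((hFc n).measurable.indicator measurableSet_Ioc).comp this).aestronglyMeasurable
      · filter_upwards [eventually_ge_atTop 1] with n hn
        refine Eventually.of_forall fun x => ?_
        have hCb0 : 0 ≤ Cb := (norm_nonneg _).trans (hCb 0 (by simp [Real.pi_pos.le]))
        by_cases hx : x / √(n : ℝ) ∈ Set.Ioc (-Real.pi) Real.pi
        · rw [Set.indicator_of_mem hx]
          simp only [hFdef]
          rw [norm_mul, Complex.norm_exp]
          refine mul_le_mul (hCb _ (Set.Ioc_subset_Icc_self hx)) ?_ (Real.exp_nonneg _) hCb0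
          rw [Real.exp_le_exp]
          have h4 := hLre (x / √(n : ℝ)) (abs_le.2 ⟨hx.1.le, hx.2⟩)
          have hn' : (0 : ℝ) < n := by exact_mod_cast hn
          rw [div_pow, Real.sq_sqrt hn'.le] at h4
          have h5 := mul_le_mul_of_nonneg_left h4 hn'.le
          rw [show ((n : ℂ) * L ((x / √(n : ℝ) : ℝ) : ℂ)).re =
            (n : ℝ) * (L ((x / √(n : ℝ) : ℝ) : ℂ)).re by
              rw [← Complex.ofReal_natCast, Complex.re_ofReal_mul]]
          refine h5.trans (le_of_eq ?_)
          field_simp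
        · rw [Set.indicator_of_notMem hx, norm_zero]
          positivity
      · exact (integrable_exp_neg_mul_sq hc).const_mul _
      · refine Eventually.of_forall fun x => ?_
        have t0 : Tendsto (fun n : ℕ => x / √(n : ℝ)) atTop (𝓝 0) :=
          tendsto_const_nhds.div_atTop (Real.tendsto_sqrt_atTop.comp tendsto_natCast_atTop_atTop)
        have h_tendsto_zero : Tendsto (fun n : ℕ => ((x / √(n : ℝ) : ℝ) : ℂ)) atTop (𝓝 0) := by
          simpa [Function.comp_def] using (Complex.continuous_ofReal.tendsto 0).comp t0
        have tb : Tendsto (fun n : ℕ => b (x / √(n : ℝ))) atTop (𝓝 (s * B s)) := by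
          have := (hbc.tendsto 0).comp t0
          simpa [hbdef, circleMap, Function.comp_def] using this
        have te : Tendsto (fun n : ℕ => Complex.exp (k ((x / √(n : ℝ) : ℝ) : ℂ) * x ^ 2)) atTop
            (𝓝 (Complex.exp (k 0 * x ^ 2))) :=
          (Complex.continuous_exp.tendsto _).comp ((hk.tendsto.comp h_tendsto_zero).mul_const _)
        refine (tb.mul te).congr' ?_
        filter_upwards [t0.eventually (Ioo_mem_nhds (neg_lt_zero.2 Real.pi_pos) Real.pi_pos),
          eventually_ge_atTop 1] with n hn hn1
        rw [Set.indicator_of_mem (Set.Ioo_subset_Ioc_self hn)]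
        simp only [hFdef]
        congr 2
        rw [hLk]
        have hn' : (0 : ℝ) < n := by exact_mod_cast hn1
        have h6 : ((√(n : ℝ) : ℝ) : ℂ) ^ 2 = n := by
          rw [← Complex.ofReal_pow, Real.sq_sqrt hn'.le]; simp
        have hnC : (n : ℂ) ≠ 0 := by exact_mod_cast hn'.ne'
        push_cast
        rw [div_pow, h6]
        field_simp
    refine ((hlim.const_mul _).congr' ?_)
    filter_upwards [eventually_ge_atTop 1] with n hn
    exact (h_integral n hn).symm

/-- Integration by parts for Taylor coefficients of powers (a form of Lagrange inversion). -/
theorem succ_mul_cauchyCoeff_mul_exp {s : ℝ} (hs : 0 < s) {q q' Q Q' : ℂ → ℂ}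
    (hq : ∀ z, HasDerivAt q (q' z) z) (hq' : Continuous q') (hQ : ∀ z, HasDerivAt Q (Q' z) z)
    (hQ' : Continuous Q') (m : ℕ) :
    (m + 1) * cauchyCoeff s (m + 1)
        (fun z => Q z * (1 - z * q' z) * Complex.exp ((m + 1) * q z)) =
      cauchyCoeff s m (fun z => Q' z * Complex.exp ((m + 1) * q z)) := by
  have hqc : Continuous q := continuous_iff_continuousAt.2 fun z => (hq z).continuousAt
  have hQc : Continuous Q := continuous_iff_continuousAt.2 fun z => (hQ z).continuousAt
  have hder := cauchyCoeff_deriv hs m (g := fun z => Q z * Complex.exp ((m + 1) * q z))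
    (fun z => (hQ z).mul (((hq z).const_mul ((m : ℂ) + 1)).cexp)) (by fun_prop)
  have e1 : (fun z => Q' z * Complex.exp ((m + 1) * q z) +
      Q z * (Complex.exp ((m + 1) * q z) * (((m : ℂ) + 1) * q' z))) =
      fun z => Q' z * Complex.exp ((m + 1) * q z) +
      ((m : ℂ) + 1) * (Q z * q' z * Complex.exp ((m + 1) * q z)) := by
    funext z; ring
  have e2 : (fun z => Q z * (1 - z * q' z) * Complex.exp ((m + 1) * q z)) =
      fun z => Q z * Complex.exp ((m + 1) * q z) +
      (-1) * (z * (Q z * q' z * Complex.exp ((m + 1) * q z))) := by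
    funext z; ring
  rw [e1, cauchyCoeff_add hs _ (by fun_prop) (by fun_prop), cauchyCoeff_const_mul] at hder
  rw [e2, cauchyCoeff_add hs _ (by fun_prop) (by fun_prop), cauchyCoeff_const_mul,
    cauchyCoeff_succ_X_mul hs, mul_add, ← hder]
  ring

/-- If `T = G(X(z))` and `X = z exp (q (X))`, then the coefficients of `exp T` have a
universal `n ^ (-5/2)` asymptotic behaviour. -/
theorem tendsto_cauchyCoeff_forest {s : ℝ} (hs : 0 < s) {q q' G r r' : ℂ → ℂ}
    (hq : ∀ z, HasDerivAt q (q' z) z) (hq' : Continuous q')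
    (hr : ∀ z, HasDerivAt r (r' z) z) (hr' : Differentiable ℂ r')
    (hG : ∀ z, HasDerivAt G (r z * (1 - z * q' z)) z) (hq'd : Differentiable ℂ q')
    (hsaddle : s * q' s = 1) (hrs : r s + s * r' s ≠ 0) {c : ℝ} (hc : 0 < c)
    (hdecay : ∀ θ : ℝ, |θ| ≤ Real.pi →
      (q (s * Complex.exp (θ * Complex.I))).re - (q s).re ≤ -c * θ ^ 2) :
    ∃ C : ℂ, C ≠ 0 ∧ Tendsto (fun n : ℕ => (√(n : ℝ) : ℂ) * ((s * Complex.exp (-q s)) ^ n *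
      (n ^ 2 * cauchyCoeff s n
        (fun z => Complex.exp (G z) * (1 - z * q' z) * Complex.exp (n * q z))))) atTop (𝓝 C) := by
  have hqd : Differentiable ℂ q := fun z => (hq z).differentiableAt
  have hrd : Differentiable ℂ r := fun z => (hr z).differentiableAt
  have hGd : Differentiable ℂ G := fun z => (hG z).differentiableAt
  have hrc := hrd.continuous
  have hGc := hGd.continuous
  have hrc' := hr'.continuous
  set B : ℂ → ℂ := fun z => (1 * r z + z * r' z) * Complex.exp (G z) +
    z * r z * (Complex.exp (G z) * (r z * (1 - z * q' z))) with hBdef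
  have hBs : B s ≠ 0 := by
    have : B s = (r s + s * r' s) * Complex.exp (G s) := by
      simp only [hBdef, hsaddle]; ring
    rw [this]
    exact mul_ne_zero hrs (Complex.exp_ne_zero _)
  obtain ⟨C, hC, hlim⟩ := tendsto_cauchyCoeff_mul_exp hs hqd (B := B) (by simp only [hBdef]; fun_prop)
    (by rw [(hq s).deriv, hsaddle]) hBs hc hdecay
  refine ⟨C, hC, hlim.congr' ?_⟩
  filter_upwards [eventually_ge_atTop 1] with n hn
  obtain ⟨m, rfl⟩ : ∃ m, n = m + 1 := ⟨n - 1, by lia⟩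
  congr 2
  have h1 := succ_mul_cauchyCoeff_mul_exp hs hq hq' (Q := fun z => Complex.exp (G z))
    (fun z => (hG z).cexp) (by fun_prop) m
  have h2 := succ_mul_cauchyCoeff_mul_exp hs hq hq' (Q := fun z => z * r z * Complex.exp (G z))
    (Q' := B) (fun z => ((hasDerivAt_id z).mul (hr z)).mul (hG z).cexp)
    (by simp only [hBdef]; fun_prop) m
  have e : (fun z => z * r z * Complex.exp (G z) * (1 - z * q' z) * Complex.exp ((m + 1) * q z)) =
      fun z => z * (Complex.exp (G z) * (r z * (1 - z * q' z)) * Complex.exp ((m + 1) * q z)) := by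
    funext z; ring
  rw [e, cauchyCoeff_succ_X_mul hs, ← h1] at h2
  push_cast
  rw [← h2]
  ring

/-- The exponent `q` of the kernel `exp q` for rooted trees with a maximal matching. -/
noncomputable def matchingExponent (z : ℂ) : ℂ := z ^ 2 * Complex.exp (2 * z)

/-- The derivative of `matchingExponent`. -/
noncomputable def matchingExponentDeriv (z : ℂ) : ℂ :=
  2 * z * Complex.exp (2 * z) + 2 * z ^ 2 * Complex.exp (2 * z)

/-- The generating function of trees with a maximal matching, in terms of the rooted one. -/
noncomputable def matchingTree (z : ℂ) : ℂ :=
  z + z ^ 2 * Complex.exp (2 * z) / 2 - z ^ 3 * Complex.exp (2 * z)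
    - z ^ 4 * Complex.exp (4 * z) / 2

theorem hasDerivAt_exp_const_mul (a z : ℂ) :
    HasDerivAt (fun z => Complex.exp (a * z)) (a * Complex.exp (a * z)) z := by
  have := ((hasDerivAt_id z).const_mul a).cexp
  simpa [mul_comm] using this

theorem hasDerivAt_matchingExponent (z : ℂ) :
    HasDerivAt matchingExponent (matchingExponentDeriv z) z := by
  have := (hasDerivAt_pow 2 z).mul (hasDerivAt_exp_const_mul 2 z)
  refine this.congr_deriv ?_
  simp only [matchingExponentDeriv]
  push_cast
  ring

theorem differentiable_matchingExponent : Differentiable ℂ matchingExponent :=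
  fun z => (hasDerivAt_matchingExponent z).differentiableAt

theorem differentiable_matchingExponentDeriv : Differentiable ℂ matchingExponentDeriv := by
  unfold matchingExponentDeriv
  fun_prop

theorem hasDerivAt_matchingTree (z : ℂ) :
    HasDerivAt matchingTree
      ((1 + z * Complex.exp (2 * z)) * (1 - z * matchingExponentDeriv z)) z := by
  have h2 := hasDerivAt_exp_const_mul 2 z
  have h4 := hasDerivAt_exp_const_mul 4 z
  have := (((hasDerivAt_id z).add (((hasDerivAt_pow 2 z).mul h2).div_const 2)).sub
    ((hasDerivAt_pow 3 z).mul h2)).sub (((hasDerivAt_pow 4 z).mul h4).div_const 2)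
  refine this.congr_deriv ?_
  simp only [matchingExponentDeriv]
  rw [show Complex.exp (4 * z) = Complex.exp (2 * z) ^ 2 by
    rw [← Complex.exp_nat_mul]; ring_nf]
  push_cast
  ring

theorem differentiable_matchingTree : Differentiable ℂ matchingTree :=
  fun z => (hasDerivAt_matchingTree z).differentiableAt

/-- The kernel whose Taylor coefficients count forests with a maximal matching and with
prescribed numbers of separated roots of each kind. -/
noncomputable def matchingKernel (N h p : ℕ) (z : ℂ) : ℂ :=
  Complex.exp (matchingTree z) * (1 - z * matchingExponentDeriv z) *
    Complex.exp (N * matchingExponent z) * (Complex.exp ((h + 2 * p) * z) * z ^ p)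

theorem differentiable_matchingKernel (N h p : ℕ) : Differentiable ℂ (matchingKernel N h p) := by
  have := differentiable_matchingTree
  have := differentiable_matchingExponentDeriv
  have := differentiable_matchingExponent
  unfold matchingKernel
  fun_prop

/-- The number of forests with a maximal matching having `m` free vertices and separated roots:
`u` unmatched ones, `h` ones matched outside the forest and `p` ones matched inside the forest. -/
noncomputable def matchingCoeff (s : ℝ) (m u h p : ℕ) : ℂ :=
  m.factorial * cauchyCoeff s m (matchingKernel (m + u + h + p) h p)

theorem factorial_mul_div_factorial {m l : ℕ} (hl : l ∈ Finset.range (m + 1)) (x : ℂ) :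
    (m.factorial : ℂ) * (x / (l.factorial : ℂ)) =
      m.choose l • (((m - l).factorial : ℂ) * x) := by
  have hlm : l ≤ m := by simpa [Nat.lt_succ_iff] using hl
  rw [← Nat.choose_mul_factorial_mul_factorial hlm]
  have : (l.factorial : ℂ) ≠ 0 := by exact_mod_cast l.factorial_ne_zero
  simp only [nsmul_eq_mul]
  push_cast
  field_simp

theorem matchingCoeff_unmatched {s : ℝ} (hs : 0 < s) (m u h p : ℕ) :
    matchingCoeff s m (u + 1) h p =
      ∑ l ∈ Finset.range (m + 1), m.choose l • matchingCoeff s (m - l) u h (p + l) := by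
  unfold matchingCoeff
  have e : matchingKernel (m + (u + 1) + h + p) h p = fun z =>
      matchingKernel (m + u + h + p) h p z * Complex.exp (z * (z * Complex.exp (2 * z))) := by
    funext z
    simp only [matchingKernel]
    rw [show ((m + (u + 1) + h + p : ℕ) : ℂ) * matchingExponent z =
      (m + u + h + p : ℕ) * matchingExponent z + z * (z * Complex.exp (2 * z)) by
        simp only [matchingExponent]; push_cast; ring, Complex.exp_add]
    ring
  rw [e, cauchyCoeff_mul_exp hs _ (differentiable_matchingKernel _ _ _) (by fun_prop),
    Finset.mul_sum]
  refine Finset.sum_congr rfl fun l hl => ?_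
  rw [factorial_mul_div_factorial hl]
  congr 4
  funext z
  have hlm : l ≤ m := by simpa [Nat.lt_succ_iff] using hl
  rw [show m - l + u + h + (p + l) = m + u + h + p by lia]
  simp only [matchingKernel]
  rw [mul_pow, ← Complex.exp_nat_mul]
  push_cast
  rw [show ((h : ℂ) + 2 * (p + l)) * z = (h + 2 * p) * z + l * (2 * z) by ring, Complex.exp_add]
  ring

theorem matchingCoeff_half {s : ℝ} (hs : 0 < s) (m u h p : ℕ) :
    matchingCoeff s m u (h + 1) p =
      ∑ l ∈ Finset.range (m + 1), m.choose l • matchingCoeff s (m - l) (u + 1 + l) h p := by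
  unfold matchingCoeff
  have e : matchingKernel (m + u + (h + 1) + p) (h + 1) p = fun z =>
      matchingKernel (m + u + h + p + 1) h p z * Complex.exp (z * 1) := by
    funext z
    simp only [matchingKernel]
    rw [show m + u + (h + 1) + p = m + u + h + p + 1 by ring]
    push_cast
    rw [show ((h : ℂ) + 1 + 2 * p) * z = (h + 2 * p) * z + z * 1 by ring, Complex.exp_add]
    ring
  rw [e, cauchyCoeff_mul_exp hs _ (differentiable_matchingKernel _ _ _) (by fun_prop),
    Finset.mul_sum]
  refine Finset.sum_congr rfl fun l hl => ?_
  rw [factorial_mul_div_factorial hl]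
  congr 4
  funext z
  have hlm : l ≤ m := by simpa [Nat.lt_succ_iff] using hl
  rw [show m - l + (u + 1 + l) + h + p = m + u + h + p + 1 by lia]
  simp

theorem matchingCoeff_zero_matched {s : ℝ} (hs : 0 < s) (u h p : ℕ) :
    matchingCoeff s 0 u h (p + 1) = 0 := by
  simp [matchingCoeff, cauchyCoeff_zero hs (differentiable_matchingKernel _ _ _), matchingKernel]

theorem matchingCoeff_succ_matched {s : ℝ} (hs : 0 < s) (m u h p : ℕ) :
    matchingCoeff s (m + 1) u h (p + 1) = (m + 1) * matchingCoeff s m u (h + 2) p := by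
  unfold matchingCoeff
  have e : matchingKernel (m + 1 + u + h + (p + 1)) h (p + 1) = fun z =>
      z * matchingKernel (m + u + (h + 2) + p) (h + 2) p z := by
    funext z
    simp only [matchingKernel]
    rw [show m + 1 + u + h + (p + 1) = m + u + (h + 2) + p by ring]
    push_cast
    rw [show ((h : ℂ) + 2 * (p + 1)) * z = (h + 2 + 2 * p) * z by ring]
    ring
  rw [e, cauchyCoeff_succ_X_mul hs, Nat.factorial_succ]
  push_cast
  ring

theorem matchingCoeff_no_roots {s : ℝ} (hs : 0 < s) (m : ℕ) :
    matchingCoeff s (m + 1) 0 0 0 = matchingCoeff s m 1 0 0 + matchingCoeff s m 0 0 1 := by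
  have key := succ_mul_cauchyCoeff_mul_exp hs hasDerivAt_matchingExponent
    differentiable_matchingExponentDeriv.continuous
    (fun z => (hasDerivAt_matchingTree z).cexp) (by
      have := differentiable_matchingExponentDeriv.continuous
      have := differentiable_matchingTree.continuous
      fun_prop) m
  unfold matchingCoeff
  rw [← mul_add, ← cauchyCoeff_add hs _ (differentiable_matchingKernel _ _ _).continuous
    (differentiable_matchingKernel _ _ _).continuous, Nat.factorial_succ]
  push_cast
  rw [mul_comm ((m : ℂ) + 1), mul_assoc]
  congr 1
  convert key using 3
  · funext z
    simp [matchingKernel]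
  · simp [matchingKernel]
    ring

theorem matchingCoeff_zero {s : ℝ} (hs : 0 < s) : matchingCoeff s 0 0 0 0 = 1 := by
  simp [matchingCoeff, cauchyCoeff_zero hs (differentiable_matchingKernel _ _ _), matchingKernel,
    matchingTree]

/-- The number of forests with `m` free vertices and `k` separated roots. -/
noncomputable def forestCoeff (s : ℝ) (m k : ℕ) : ℂ :=
  m.factorial * cauchyCoeff s m
    (fun z => Complex.exp (z - z ^ 2 / 2) * (1 - z * 1) * Complex.exp ((m + k) * z))

theorem forestCoeff_succ {s : ℝ} (hs : 0 < s) (m k : ℕ) :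
    forestCoeff s m (k + 1) =
      ∑ l ∈ Finset.range (m + 1), m.choose l • forestCoeff s (m - l) (k + l) := by
  unfold forestCoeff
  have e : (fun z : ℂ => Complex.exp (z - z ^ 2 / 2) * (1 - z * 1) *
      Complex.exp ((m + (k + 1 : ℕ)) * z)) = fun z => (Complex.exp (z - z ^ 2 / 2) * (1 - z * 1) *
      Complex.exp ((m + k) * z)) * Complex.exp (z * 1) := by
    funext z
    rw [mul_assoc _ (Complex.exp _) (Complex.exp _), ← Complex.exp_add]
    push_cast
    ring_nf
  rw [e, cauchyCoeff_mul_exp hs _ (by fun_prop) (by fun_prop), Finset.mul_sum]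
  refine Finset.sum_congr rfl fun l hl => ?_
  rw [factorial_mul_div_factorial hl]
  congr 4
  funext z
  have hlm : l ≤ m := by simpa [Nat.lt_succ_iff] using hl
  push_cast [hlm]
  ring_nf

theorem forestCoeff_no_roots {s : ℝ} (hs : 0 < s) (m : ℕ) :
    forestCoeff s (m + 1) 0 = forestCoeff s m 1 := by
  have hT : ∀ z : ℂ, HasDerivAt (fun z : ℂ => z - z ^ 2 / 2) (1 * (1 - z * 1)) z := by
    intro z
    refine ((hasDerivAt_id z).sub ((hasDerivAt_pow 2 z).div_const 2)).congr_deriv ?_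
    push_cast
    ring
  have key := succ_mul_cauchyCoeff_mul_exp hs (q := fun z => z) (q' := fun _ => 1)
    (fun z => hasDerivAt_id z) (by fun_prop) (fun z => (hT z).cexp) (by fun_prop) m
  unfold forestCoeff
  rw [Nat.factorial_succ]
  push_cast
  rw [mul_comm ((m : ℂ) + 1), mul_assoc]
  congr 1
  simpa using key

theorem forestCoeff_zero {s : ℝ} (hs : 0 < s) : forestCoeff s 0 0 = 1 := by
  unfold forestCoeff
  rw [cauchyCoeff_zero hs (by fun_prop)]
  simp

theorem exists_matching_saddle :
    ∃ s : ℝ, 0 < s ∧ s < 1 / 2 ∧ 2 * s ^ 2 * (1 + s) * Real.exp (2 * s) = 1 := by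
  have hc : ContinuousOn (fun s : ℝ => 2 * s ^ 2 * (1 + s) * Real.exp (2 * s))
      (Set.Icc 0 (1 / 2)) := by fun_prop
  have he : (2 : ℝ) < Real.exp 1 := by
    have := Real.exp_one_gt_d9
    linarith
  obtain ⟨s, hs, h⟩ := intermediate_value_Ioo (by norm_num) hc
    (show (1 : ℝ) ∈ Set.Ioo _ _ by constructor <;> norm_num; linarith)
  exact ⟨s, hs.1, hs.2, h⟩

theorem one_sub_cos_ge {θ : ℝ} (hθ : |θ| ≤ Real.pi) :
    2 / Real.pi ^ 2 * θ ^ 2 ≤ 1 - Real.cos θ := by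
  have := Real.cos_le_one_sub_mul_cos_sq hθ
  linarith

theorem matchingExponent_ofReal (s : ℝ) :
    matchingExponent s = ((s ^ 2 * Real.exp (2 * s) : ℝ) : ℂ) := by
  simp [matchingExponent]

theorem matchingExponent_decay {s : ℝ} (hs : 0 < s) {θ : ℝ} (hθ : |θ| ≤ Real.pi) :
    (matchingExponent (s * Complex.exp (θ * Complex.I))).re - (matchingExponent s).re ≤
      -(s ^ 2 * (2 * s * Real.exp (-(2 * s))) * (2 / Real.pi ^ 2)) * θ ^ 2 := by
  have h1 : (matchingExponent (s * Complex.exp (θ * Complex.I))).re ≤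
      s ^ 2 * Real.exp (2 * s * Real.cos θ) := by
    refine (Complex.re_le_norm _).trans (le_of_eq ?_)
    simp only [matchingExponent]
    rw [norm_mul, norm_pow, norm_mul, Complex.norm_exp_ofReal_mul_I, Complex.norm_exp,
      Complex.norm_real, Real.norm_of_nonneg hs.le, mul_one, Complex.exp_ofReal_mul_I]
    simp
    ring_nf
    left
    rw [← Complex.ofReal_cos, Complex.ofReal_re]
  rw [matchingExponent_ofReal, Complex.ofReal_re]
  have hcos := one_sub_cos_ge hθ
  have h2 : Real.exp (2 * s * Real.cos θ) * (2 * s * (1 - Real.cos θ)) ≤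
      Real.exp (2 * s) - Real.exp (2 * s * Real.cos θ) := by
    have := Real.add_one_le_exp (2 * s * (1 - Real.cos θ))
    have hpos := Real.exp_pos (2 * s * Real.cos θ)
    have hexp : Real.exp (2 * s) =
        Real.exp (2 * s * Real.cos θ) * Real.exp (2 * s * (1 - Real.cos θ)) := by
      rw [← Real.exp_add]
      ring_nf
    have := mul_le_mul_of_nonneg_left this hpos.le
    rw [hexp]
    linarith
  have h3 : Real.exp (-(2 * s)) ≤ Real.exp (2 * s * Real.cos θ) := by
    rw [Real.exp_le_exp]
    nlinarith [Real.neg_one_le_cos θ]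
  have h4 : Real.exp (-(2 * s)) * (2 * s * (2 / Real.pi ^ 2 * θ ^ 2)) ≤
      Real.exp (2 * s * Real.cos θ) * (2 * s * (1 - Real.cos θ)) := by
    gcongr
  have h5 := mul_le_mul_of_nonneg_left (h4.trans h2) (sq_nonneg s)
  linarith

theorem tendsto_matchingCoeff {s : ℝ} (hs : 0 < s)
    (hsaddle : 2 * s ^ 2 * (1 + s) * Real.exp (2 * s) = 1) :
    ∃ C : ℂ, C ≠ 0 ∧ Tendsto (fun n : ℕ => (√(n : ℝ) : ℂ) *
      ((s * Complex.exp (-matchingExponent s)) ^ n *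
      (n ^ 2 * (matchingCoeff s n 0 0 0 / n.factorial)))) atTop (𝓝 C) := by
  have hd : ∀ z : ℂ, HasDerivAt (fun z => 1 + z * Complex.exp (2 * z))
      (1 * Complex.exp (2 * z) + z * (2 * Complex.exp (2 * z))) z := fun z =>
    ((hasDerivAt_id z).mul (hasDerivAt_exp_const_mul 2 z)).const_add 1
  obtain ⟨C, hC, h⟩ := tendsto_cauchyCoeff_forest hs hasDerivAt_matchingExponent
    differentiable_matchingExponentDeriv.continuous hd (by fun_prop) hasDerivAt_matchingTree
    differentiable_matchingExponentDeriv (by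
      have : (2 * s ^ 2 * (1 + s) * Complex.exp (2 * s) : ℂ) = 1 := by exact_mod_cast hsaddle
      simp only [matchingExponentDeriv]
      linear_combination this) (by
      have : (1 + s * Complex.exp (2 * s) + s * (1 * Complex.exp (2 * s) +
        s * (2 * Complex.exp (2 * s))) : ℂ) = ((1 + s * Real.exp (2 * s) + s * (1 * Real.exp (2 * s) +
        s * (2 * Real.exp (2 * s))) : ℝ) : ℂ) := by push_cast; rfl
      rw [this]
      exact_mod_cast (by positivity))
    (c := s ^ 2 * (2 * s * Real.exp (-(2 * s))) * (2 / Real.pi ^ 2))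
    (by have := Real.pi_pos; positivity) (fun θ hθ => matchingExponent_decay hs hθ)
  refine ⟨C, hC, h.congr fun n => ?_⟩
  have : (n.factorial : ℂ) ≠ 0 := by exact_mod_cast n.factorial_ne_zero
  unfold matchingCoeff
  rw [mul_div_cancel_left₀ _ this]
  congr 4
  funext z
  simp [matchingKernel]

theorem tendsto_forestCoeff :
    ∃ C : ℂ, C ≠ 0 ∧ Tendsto (fun n : ℕ => (√(n : ℝ) : ℂ) *
      ((((1 : ℝ) : ℂ) * Complex.exp (-((1 : ℝ) : ℂ))) ^ n *
      (n ^ 2 * (forestCoeff 1 n 0 / n.factorial)))) atTop (𝓝 C) := by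
  have hT : ∀ z : ℂ, HasDerivAt (fun z : ℂ => z - z ^ 2 / 2) (1 * (1 - z * 1)) z := by
    intro z
    refine ((hasDerivAt_id z).sub ((hasDerivAt_pow 2 z).div_const 2)).congr_deriv ?_
    push_cast
    ring
  obtain ⟨C, hC, h⟩ := tendsto_cauchyCoeff_forest one_pos (q := fun z => z) (q' := fun _ => 1)
    (r := fun _ => 1) (r' := fun _ => 0) (fun z => hasDerivAt_id z) (by fun_prop)
    (fun z => hasDerivAt_const z 1) (by fun_prop) hT (by fun_prop) (by simp) (by simp)
    (c := 2 / Real.pi ^ 2) (by have := Real.pi_pos; positivity) (by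
      intro θ hθ
      have := one_sub_cos_ge hθ
      rw [Complex.ofReal_one, one_mul, Complex.exp_ofReal_mul_I_re, Complex.one_re]
      linarith)
  refine ⟨C, hC, h.congr fun n => ?_⟩
  have : (n.factorial : ℂ) ≠ 0 := by exact_mod_cast n.factorial_ne_zero
  unfold forestCoeff
  rw [mul_div_cancel_left₀ _ this]
  congr 4
  funext z
  simp

theorem one_lt_exp_matchingExponent_div {s : ℝ} (hs : 0 < s) (hs2 : s < 1 / 2)
    (hsaddle : 2 * s ^ 2 * (1 + s) * Real.exp (2 * s) = 1) :
    1 < Real.exp (s ^ 2 * Real.exp (2 * s) - 1) / s := by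
  set y := s ^ 2 * Real.exp (2 * s) with hy
  have h1 : 2 * y * (1 + s) = 1 := by rw [hy]; linarith
  have h2 : 1 / 3 < y := by nlinarith
  rw [one_lt_div hs]
  have h4 := Real.log_two_gt_d9
  have h5 : -Real.log 2 ≤ y - 1 := by linarith
  calc s < 1 / 2 := hs2
    _ = Real.exp (-Real.log 2) := by rw [Real.exp_neg, Real.exp_log two_pos]; norm_num
    _ ≤ Real.exp (y - 1) := Real.exp_le_exp.2 h5

/-- A ratio of two sequences given by the coefficients above grows exponentially. -/
theorem exists_tendsto_ratio {a b : ℕ → ℕ}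
    (ha : ∀ s : ℝ, 0 < s → ∀ n, (a n : ℂ) = matchingCoeff s n 0 0 0)
    (hb : ∀ s : ℝ, 0 < s → ∀ n, (b n : ℂ) = forestCoeff s n 0) :
    ∃ D β : ℝ, 0 < D ∧ 1 < β ∧
      Tendsto (fun n : ℕ => ((a n : ℝ) / (b n : ℝ)) / β ^ n) atTop (𝓝 D) := by
  obtain ⟨s, hs, hs2, hsaddle⟩ := exists_matching_saddle
  obtain ⟨C₁, hC₁, h₁⟩ := tendsto_matchingCoeff hs hsaddle
  obtain ⟨C₂, hC₂, h₂⟩ := tendsto_forestCoeff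
  set β := Real.exp (s ^ 2 * Real.exp (2 * s) - 1) / s with hβ
  have hβ1 : 1 < β := one_lt_exp_matchingExponent_div hs hs2 hsaddle
  have hlim : Tendsto (fun n : ℕ => ((((a n : ℝ) / (b n : ℝ)) / β ^ n : ℝ) : ℂ)) atTop
      (𝓝 (C₁ / C₂)) := by
    refine (h₁.div h₂ hC₂).congr' ?_
    filter_upwards [eventually_ge_atTop 1] with n hn
    simp only [Pi.div_apply]
    rw [← ha s hs, ← hb 1 one_pos]
    have hn' : (n : ℂ) ≠ 0 := by exact_mod_cast (show n ≠ 0 by lia)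
    have hsq : ((√(n : ℝ) : ℝ) : ℂ) ≠ 0 := by
      have : (0 : ℝ) < n := by exact_mod_cast hn
      exact_mod_cast (Real.sqrt_pos.2 this).ne'
    have hfac : (n.factorial : ℂ) ≠ 0 := by exact_mod_cast n.factorial_ne_zero
    have hsC : (s : ℂ) ≠ 0 := by exact_mod_cast hs.ne'
    have hβC : (β : ℂ) = Complex.exp (matchingExponent s) * Complex.exp (-1) / s := by
      rw [matchingExponent_ofReal, ← Complex.exp_add, hβ]
      push_cast
      rfl
    have e1 := Complex.exp_ne_zero (matchingExponent s)
    have e2 := Complex.exp_ne_zero (-1)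
    push_cast
    rw [hβC, Complex.exp_neg (matchingExponent s), mul_div_mul_left _ _ hsq, mul_pow, mul_pow,
      div_pow, mul_pow, inv_pow, one_pow]
    by_cases hbn : (b n : ℂ) = 0
    · simp [hbn]
    field_simp
  have hre := (Complex.continuous_re.tendsto _).comp hlim
  have him := (Complex.continuous_im.tendsto _).comp hlim
  simp only [Function.comp_def, Complex.ofReal_re, Complex.ofReal_im] at hre him
  have him0 : (C₁ / C₂).im = 0 := tendsto_nhds_unique him tendsto_const_nhds
  have hre0 : 0 ≤ (C₁ / C₂).re := ge_of_tendsto' hre fun n => by positivity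
  refine ⟨(C₁ / C₂).re, β, lt_of_le_of_ne hre0 fun h => ?_, hβ1, hre⟩
  exact div_ne_zero hC₁ hC₂ (Complex.ext h.symm him0)

namespace SimpleGraph

variable {V : Type*}

/-- A graph is a forest rooted at `R` when it is acyclic and no two vertices of `R` lie in the
same component. -/
def IsRootedForest (G : SimpleGraph V) (R : Set V) : Prop :=
  G.IsAcyclic ∧ ∀ a ∈ R, ∀ b ∈ R, G.Reachable a b → a = b

/-- The star with centre `v` whose leaves are the elements of `J` other than `v`. -/
def starOn (v : V) (J : Finset V) : SimpleGraph V :=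
  fromRel fun a b => a = v ∧ b ∈ J

theorem starOn_adj {v : V} {J : Finset V} (hv : v ∉ J) {a b : V} :
    (starOn v J).Adj a b ↔ (a = v ∧ b ∈ J) ∨ (b = v ∧ a ∈ J) := by
  simp only [starOn, fromRel_adj]
  grind

theorem Reachable.of_sup_edge {G : SimpleGraph V} {v w a b : V}
    (h : (G ⊔ edge v w).Reachable a b) :
    G.Reachable a b ∨ (G.Reachable a v ∧ G.Reachable w b) ∨
      (G.Reachable a w ∧ G.Reachable v b) := by
  obtain ⟨p⟩ := h
  induction p with
  | nil => exact Or.inl (Reachable.refl _)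
  | cons hac p ih =>
    rw [sup_adj, edge_adj] at hac
    rcases hac with hac | ⟨⟨rfl, rfl⟩ | ⟨rfl, rfl⟩, -⟩
    · exact ih.imp hac.reachable.trans
        (Or.imp (And.imp_left hac.reachable.trans) (And.imp_left hac.reachable.trans))
    · exact ih.elim (fun h => .inr (.inl ⟨.refl _, h⟩))
        (Or.elim · (fun h => .inr (.inl ⟨.refl _, h.2⟩)) (fun h => .inl h.2))
    · exact ih.elim (fun h => .inr (.inr ⟨.refl _, h⟩))
        (Or.elim · (fun h => .inl h.2) (fun h => .inr (.inr ⟨.refl _, h.2⟩)))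

theorem isRootedForest_sup_edge {G : SimpleGraph V} {R : Set V} {v w : V} (hv : v ∈ R)
    (hw : w ∉ R) (hvw : ¬G.Adj v w) :
    (G ⊔ edge v w).IsRootedForest R ↔ G.IsRootedForest (insert w R) := by
  have hne : v ≠ w := fun h => hw (h ▸ hv)
  have hedge : (G ⊔ edge v w).Adj v w := by simp [edge_adj, hne]
  constructor
  · rintro ⟨hG, hR⟩
    have hG' := isAcyclic_sup_fromEdgeSet_iff.1 hG
    have hn : ¬G.Reachable v w := fun h => (hG'.2 h).elim hne hvw
    have key : ∀ b ∈ R, ¬G.Reachable w b := fun b hb h => by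
      have := hR v hv b hb (hedge.reachable.trans (h.mono le_sup_left))
      exact hn (this ▸ h.symm)
    refine ⟨hG'.1, ?_⟩
    rintro a (rfl | ha) b (rfl | hb) hab
    · rfl
    · exact absurd hab (key b hb)
    · exact absurd hab.symm (key a ha)
    · exact hR a ha b hb (hab.mono le_sup_left)
  · rintro ⟨hG, hR⟩
    refine ⟨hG.sup_edge_of_not_reachable fun h => hne (hR v (.inr hv) w (.inl rfl) h), ?_⟩
    intro a ha b hb hab
    rcases hab.of_sup_edge with h | h | h
    · exact hR a (.inr ha) b (.inr hb) h
    · exact absurd (hR w (.inl rfl) b (.inr hb) h.2) (by rintro rfl; exact hw hb)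
    · exact absurd (hR a (.inr ha) w (.inl rfl) h.1) (by rintro rfl; exact hw ha)

theorem isRootedForest_sup_starOn {G : SimpleGraph V} {R : Set V} {v : V} (hv : v ∈ R)
    {J : Finset V} (hJ : ∀ w ∈ J, w ∉ R) (hvJ : ∀ w ∈ J, ¬G.Adj v w) :
    (G ⊔ starOn v J).IsRootedForest R ↔ G.IsRootedForest (R ∪ J) := by
  classical
  induction J using Finset.induction_on generalizing R with
  | empty =>
    have : starOn v ∅ = ⊥ := by ext; simp [starOn]
    simp [this]
  | insert w J hwJ ih =>
    have hvJ' : v ∉ J := fun h => hJ v (Finset.mem_insert_of_mem h) hv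
    have hvw : v ≠ w := fun h => hJ w (Finset.mem_insert_self _ _) (h ▸ hv)
    have hsup : G ⊔ starOn v (insert w J) = (G ⊔ starOn v J) ⊔ edge v w := by
      ext a b
      simp only [sup_adj, edge_adj, starOn_adj hvJ',
        starOn_adj (show v ∉ insert w J by simp [hvw, hvJ']), Finset.mem_insert]
      grind
    have hadj : ¬(G ⊔ starOn v J).Adj v w := by
      rw [sup_adj, starOn_adj hvJ']
      have := hvJ w (Finset.mem_insert_self _ _)
      grind
    rw [hsup, isRootedForest_sup_edge hv (hJ w (Finset.mem_insert_self _ _)) hadj,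
      ih (Set.mem_insert_of_mem _ hv) (by grind) (by grind)]
    congr! 1
    ext
    simp [or_assoc]

end SimpleGraph

/-- Shifting by `e` matches up two classes of elements of a Boolean algebra. -/
theorem Nat.card_subtype_eq_of_sup {B : Type*} [BooleanAlgebra B] {P Q : B → Prop} (e : B)
    (hP : ∀ x, P x → e ≤ x) (hQ : ∀ x, Q x → Disjoint x e)
    (h : ∀ x, Disjoint x e → (P (x ⊔ e) ↔ Q x)) :
    Nat.card {x // P x} = Nat.card {x // Q x} :=
  Nat.card_congr
    { toFun := fun x => ⟨x.1 \ e, (h _ disjoint_sdiff_self_left).1 (by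
        rw [sdiff_sup_cancel (hP _ x.2)]; exact x.2)⟩
      invFun := fun x => ⟨x.1 ⊔ e, (h _ (hQ _ x.2)).2 x.2⟩
      left_inv := fun x => Subtype.ext (sdiff_sup_cancel (hP _ x.2))
      right_inv := fun x => Subtype.ext (hQ _ x.2).sup_sdiff_cancel_right }

open Classical in
/-- Counting a finite class by the unique label of each of its elements. -/
theorem Nat.card_subtype_eq_sum {X ι : Type*} [Finite X] {P : X → Prop} {R : X → ι → Prop}
    (t : Finset ι) (h : ∀ x, P x → ∃! j, j ∈ t ∧ R x j) :
    Nat.card {x // P x} = ∑ j ∈ t, Nat.card {x // P x ∧ R x j} := by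
  have := Fintype.ofFinite X
  simp only [Nat.card_eq_fintype_card, Fintype.card_subtype, Finset.card_filter]
  rw [Finset.sum_comm]
  refine Finset.sum_congr rfl fun x _ => ?_
  by_cases hx : P x
  · obtain ⟨j, ⟨hj, hxj⟩, hu⟩ := h x hx
    rw [Finset.sum_eq_single_of_mem j hj]
    · simp [hx, hxj]
    · intro i hi hij
      simp only [hx, true_and, ite_eq_right_iff, one_ne_zero]
      exact fun hxi => hij (hu i ⟨hi, hxi⟩)
  · simp [hx]

/-- The status of a vertex while the components of a forest are taken apart: not yet reached,
already removed, or the root of its component. A root is either unmatched, or matched to a vertex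
outside its component, or matched inside its component. -/
inductive VertexStatus
  | free
  | dead
  | unmatched
  | matchedOutside
  | matchedInside
  deriving DecidableEq

namespace VertexStatus

/-- A weight which decreases as a vertex is processed. -/
def weight : VertexStatus → ℕ
  | free => 4
  | dead => 0
  | unmatched => 1
  | matchedOutside => 2
  | matchedInside => 3

variable {V : Type*} [Fintype V]

/-- The number of vertices of a given status. -/
def count (σ : V → VertexStatus) (t : VertexStatus) : ℕ :=
  ∑ a, if σ a = t then 1 else 0

open Classical in
/-- Change the status of `v` to `s` and that of the elements of `J` to `t`. -/
noncomputable def relabel {V : Type*} (σ : V → VertexStatus) (v : V) (s : VertexStatus) (J : Finset V)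
    (t : VertexStatus) : V → VertexStatus :=
  fun a => if a = v then s else if a ∈ J then t else σ a

open Classical in
theorem count_relabel {σ : V → VertexStatus} {v : V} {J : Finset V} (s t : VertexStatus)
    (hv : v ∉ J) (hJ : ∀ w ∈ J, σ w = free) (i : VertexStatus) :
    count (relabel σ v s J t) i + ((if σ v = i then 1 else 0) + if free = i then J.card else 0) =
      count σ i + ((if s = i then 1 else 0) + if t = i then J.card else 0) := by
  have h1 : ∀ j : VertexStatus, (if j = i then 1 else 0) =
      ∑ a : V, if a = v then (if j = i then 1 else 0) else 0 := by simp
  have h2 : ∀ j : VertexStatus, (if j = i then J.card else 0) =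
      ∑ a : V, if a ∈ J then (if j = i then 1 else 0) else 0 := by
    intro j
    split_ifs <;> simp
  rw [h1 (σ v), h1 s, h2 free, h2 t, count, count]
  simp only [← Finset.sum_add_distrib]
  refine Finset.sum_congr rfl fun a _ => ?_
  have := hJ a
  simp only [relabel]
  by_cases hav : a = v
  · subst hav
    simp [hv]
    ring
  · by_cases haJ : a ∈ J
    · simp only [hav, haJ, this haJ, if_true, if_false]
      ring
    · simp [hav, haJ]

theorem sum_weight_relabel_lt {σ : V → VertexStatus} {v : V} {J : Finset V} {s t : VertexStatus}
    (hJ : ∀ w ∈ J, σ w = free) (hs : s.weight < (σ v).weight) :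
    ∑ a, (relabel σ v s J t a).weight < ∑ a, (σ a).weight := by
  classical
  refine Finset.sum_lt_sum (fun a _ => ?_) ⟨v, Finset.mem_univ _, by simpa [relabel] using hs⟩
  have := hJ a
  have ht : t.weight ≤ free.weight := by cases t <;> simp [weight]
  unfold relabel
  split_ifs with h1 h2
  · exact h1 ▸ hs.le
  · rwa [this h2]
  · exact le_rfl

theorem count_eq_zero {σ : V → VertexStatus} {t : VertexStatus} :
    count σ t = 0 ↔ ∀ a, σ a ≠ t := by
  simp [count]

theorem exists_eq_of_count_eq_succ {σ : V → VertexStatus} {t : VertexStatus} {k : ℕ}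
    (h : count σ t = k + 1) : ∃ a, σ a = t := by
  by_contra! hn
  exact absurd h (by simp [count_eq_zero.2 hn])

theorem card_filter_eq_count (σ : V → VertexStatus) (t : VertexStatus) :
    (Finset.univ.filter fun a => σ a = t).card = count σ t := by
  rw [Finset.card_filter, count]

end VertexStatus

open VertexStatus

/-- The forests compatible with the statuses of the vertices. -/
structure IsCompatibleForest {V : Type*} (σ : V → VertexStatus) (G : SimpleGraph V) : Prop where
  rooted : G.IsRootedForest {a | σ a ≠ free}
  not_adj_of_dead : ∀ a b, σ a = dead → ¬G.Adj a b

/-- A vertex is covered by `M` when it is an endpoint of an edge of `M`. -/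
def SimpleGraph.Covers {V : Type*} (M : SimpleGraph V) (a : V) : Prop := ∃ b, M.Adj a b

/-- The pairs of a forest and a matching compatible with the statuses of the vertices, such that
the matching, together with the edges outside the graph, is maximal. -/
structure IsCompatibleMatching {V : Type*} (σ : V → VertexStatus)
    (x : SimpleGraph V × SimpleGraph V) : Prop where
  forest : IsCompatibleForest σ x.1
  le : x.2 ≤ x.1
  eq_of_adj : ∀ a b c, x.2.Adj a b → x.2.Adj a c → b = c
  not_covers_unmatched : ∀ a, σ a = unmatched → ¬x.2.Covers a
  not_covers_matchedOutside : ∀ a, σ a = matchedOutside → ¬x.2.Covers a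
  covers_matchedInside : ∀ a, σ a = matchedInside → x.2.Covers a
  maximal : ∀ a b, x.1.Adj a b →
    x.2.Covers a ∨ x.2.Covers b ∨ σ a = matchedOutside ∨ σ b = matchedOutside

section Moves

variable {V : Type*} {σ : V → VertexStatus} {v : V} {J : Finset V} {G M : SimpleGraph V}

theorem isRootedForest_relabel {s t : VertexStatus} (hv : σ v ≠ free) (hJ : ∀ w ∈ J, σ w = free)
    (hs : s ≠ free) (ht : t ≠ free) (hvJ : ∀ w ∈ J, ¬G.Adj v w) :
    (G ⊔ SimpleGraph.starOn v J).IsRootedForest {a | σ a ≠ free} ↔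
      G.IsRootedForest {a | relabel σ v s J t a ≠ free} := by
  classical
  rw [SimpleGraph.isRootedForest_sup_starOn (by simpa using hv) (by simpa using hJ) hvJ]
  congr! 1
  ext a
  simp only [relabel, Set.mem_union, Set.mem_ofPred_eq, Finset.mem_coe]
  grind

theorem IsCompatibleForest.eq_of_adj_roots (h : IsCompatibleForest σ G) {a b : V}
    (ha : σ a ≠ free) (hb : σ b ≠ free) : ¬G.Adj a b := fun hab =>
  hab.ne (h.rooted.2 a ha b hb hab.reachable)

theorem isCompatibleForest_remove_root {t : VertexStatus} (hv : σ v ≠ free) (hd : σ v ≠ dead)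
    (hJ : ∀ w ∈ J, σ w = free) (ht : t ≠ free) (htd : t ≠ dead) (hvJ : ∀ w ∈ J, ¬G.Adj v w) :
    (IsCompatibleForest σ (G ⊔ SimpleGraph.starOn v J) ∧
        ∀ w, (G ⊔ SimpleGraph.starOn v J).Adj v w ↔ w ∈ J) ↔
      IsCompatibleForest (relabel σ v dead J t) G := by
  have hv' : v ∉ J := fun h => hv (hJ v h)
  have hr := isRootedForest_relabel hv hJ (s := dead) (t := t) (by simp) ht hvJ
  constructor
  · rintro ⟨⟨h1, h2⟩, h3⟩
    refine ⟨hr.1 h1, fun a b ha hab => ?_⟩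
    by_cases hav : a = v
    · subst hav
      exact hvJ b ((h3 b).1 (.inl hab)) hab
    · refine h2 a b ?_ (.inl hab)
      simp only [relabel, hav, if_false] at ha
      split_ifs at ha
      · exact absurd ha htd
      · exact ha
  · rintro ⟨h1, h2⟩
    refine ⟨⟨hr.2 h1, fun a b ha hab => ?_⟩, fun w => ?_⟩
    · rw [SimpleGraph.sup_adj, SimpleGraph.starOn_adj hv'] at hab
      have haJ : a ∉ J := fun h => by simp [hJ a h] at ha
      rcases hab with hab | ⟨rfl, -⟩ | ⟨-, h⟩
      · refine h2 a b ?_ hab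
        simp [relabel, haJ, ha]
      · exact hd ha
      · exact haJ h
    · rw [SimpleGraph.sup_adj, SimpleGraph.starOn_adj hv']
      have := h2 v w (by simp [relabel])
      have := hv'
      grind

theorem isCompatibleMatching_remove_unmatched (hv : σ v = unmatched)
    (hJ : ∀ w ∈ J, σ w = free) (hvJ : ∀ w ∈ J, ¬G.Adj v w) :
    (IsCompatibleMatching σ (G ⊔ SimpleGraph.starOn v J, M) ∧
        ∀ w, (G ⊔ SimpleGraph.starOn v J).Adj v w ↔ w ∈ J) ↔
      IsCompatibleMatching (relabel σ v dead J matchedInside) (G, M) := by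
  classical
  have hv' : v ∉ J := fun h => by simp [hJ v h] at hv
  have hF := isCompatibleForest_remove_root (t := matchedInside) (by simp [hv] : σ v ≠ free)
    (by simp [hv]) hJ (by simp) (by simp) hvJ
  constructor
  · rintro ⟨⟨h1, h2, h3, h4, h5, h6, h7⟩, h8⟩
    refine ⟨hF.1 ⟨h1, h8⟩, fun a b hab => ?_, h3, fun a ha => ?_, fun a ha => ?_, fun a ha => ?_,
      fun a b hab => ?_⟩
    · rcases h2 hab with h | h
      · exact h
      · rw [SimpleGraph.starOn_adj hv'] at h
        rcases h with ⟨rfl, -⟩ | ⟨rfl, -⟩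
        · exact absurd ⟨b, hab⟩ (h4 _ hv)
        · exact absurd ⟨a, hab.symm⟩ (h4 _ hv)
    · refine h4 a ?_
      simp only [relabel] at ha
      split_ifs at ha
      exact ha
    · refine h5 a ?_
      simp only [relabel] at ha
      split_ifs at ha
      exact ha
    · simp only [relabel] at ha
      split_ifs at ha with hav haJ
      · have := h7 v a ((h8 a).2 haJ)
        simpa [hv, hJ a haJ, h4 v hv] using this
      · exact h6 a ha
    · have hb : ∀ a, σ a = matchedOutside → relabel σ v dead J matchedInside a = matchedOutside := by
        intro a ha
        have h1 : a ≠ v := by rintro rfl; simp [hv] at ha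
        have h2 : a ∉ J := fun h => by simp [hJ a h] at ha
        simp [relabel, h1, h2, ha]
      exact (h7 a b (.inl hab)).imp_right (Or.imp_right (Or.imp (hb a) (hb b)))
  · rintro ⟨h1, h2, h3, h4, h5, h6, h7⟩
    have hd : ∀ b, ¬G.Adj v b := fun b => h1.not_adj_of_dead v b (by simp [relabel])
    have hne : ∀ a, σ a ≠ free → a ∉ J := fun a ha h => ha (hJ a h)
    refine ⟨⟨(hF.2 h1).1, h2.trans le_sup_left, h3, fun a ha => ?_, fun a ha => ?_, fun a ha => ?_,
      fun a b hab => ?_⟩, (hF.2 h1).2⟩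
    · by_cases hav : a = v
      · subst hav
        exact fun ⟨b, hb⟩ => hd b (h2 hb)
      · exact h4 a (by simp [relabel, hav, hne a (by simp [ha]), ha])
    · have hav : a ≠ v := by rintro rfl; simp [hv] at ha
      exact h5 a (by simp [relabel, hav, hne a (by simp [ha]), ha])
    · have hav : a ≠ v := by rintro rfl; simp [hv] at ha
      exact h6 a (by simp [relabel, hav, hne a (by simp [ha]), ha])
    · have hb : ∀ a, relabel σ v dead J matchedInside a = matchedOutside → σ a = matchedOutside := by
        intro a ha
        simp only [relabel] at ha
        split_ifs at ha
        exact ha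
      have hc : ∀ w ∈ J, M.Covers w := fun w hw =>
        h6 w (by simp [relabel, hw, show w ≠ v by rintro rfl; exact hv' hw])
      rcases hab with hab | hab
      · exact (h7 a b hab).imp_right (Or.imp_right (Or.imp (hb a) (hb b)))
      · rw [SimpleGraph.starOn_adj hv'] at hab
        rcases hab with ⟨-, h⟩ | ⟨-, h⟩
        · exact .inr (.inl (hc _ h))
        · exact .inl (hc _ h)

theorem isCompatibleMatching_release_matchedOutside (hv : σ v = matchedOutside)
    (hJ : ∀ w ∈ J, σ w = free) (hvJ : ∀ w ∈ J, ¬G.Adj v w) :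
    (IsCompatibleMatching σ (G ⊔ SimpleGraph.starOn v J, M) ∧
        ∀ w, ((G ⊔ SimpleGraph.starOn v J).Adj v w ∧ ¬M.Covers w) ↔ w ∈ J) ↔
      IsCompatibleMatching (relabel σ v unmatched J unmatched) (G, M) := by
  classical
  have hv' : v ∉ J := fun h => by simp [hJ v h] at hv
  have hr := isRootedForest_relabel (G := G) (by simp [hv] : σ v ≠ free) hJ (s := unmatched)
    (t := unmatched) (by simp) (by simp) hvJ
  have hne : ∀ a, σ a ≠ free → a ∉ J := fun a ha h => ha (hJ a h)
  have hst : ∀ t, t ≠ unmatched → ∀ a, relabel σ v unmatched J unmatched a = t → σ a = t := by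
    intro t ht a ha
    simp only [relabel] at ha
    split_ifs at ha
    exacts [absurd ha.symm ht, absurd ha.symm ht, ha]
  have hts : ∀ a, a ≠ v → σ a ≠ free → relabel σ v unmatched J unmatched a = σ a := by
    intro a hav ha
    simp [relabel, hav, hne a ha]
  constructor
  · rintro ⟨⟨h1, h2, h3, h4, h5, h6, h7⟩, h8⟩
    refine ⟨⟨hr.1 h1.rooted, fun a b ha hab => h1.not_adj_of_dead a b (hst _ (by simp) a ha)
      (.inl hab)⟩, fun a b hab => ?_, h3, fun a ha => ?_,
      fun a ha => h5 a (hst _ (by simp) a ha), fun a ha => h6 a (hst _ (by simp) a ha),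
      fun a b hab => ?_⟩
    · rcases h2 hab with h | h
      · exact h
      · rw [SimpleGraph.starOn_adj hv'] at h
        rcases h with ⟨rfl, -⟩ | ⟨rfl, -⟩
        · exact absurd ⟨b, hab⟩ (h5 _ hv)
        · exact absurd ⟨a, hab.symm⟩ (h5 _ hv)
    · simp only [relabel] at ha
      split_ifs at ha with hav haJ
      · exact h5 a (hav ▸ hv)
      · exact ((h8 a).2 haJ).2
      · exact h4 a ha
    · have key : ∀ a b, G.Adj a b → σ a = matchedOutside →
          relabel σ v unmatched J unmatched a = matchedOutside ∨ M.Covers b := by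
        intro a b hab ha
        by_cases hav : a = v
        · subst hav
          by_contra! hcon
          exact hvJ b ((h8 b).1 ⟨.inl hab, hcon.2⟩) hab
        · exact .inl ((hts a hav (by simp [ha])).trans ha)
      rcases h7 a b (.inl hab) with h | h | h | h
      · exact .inl h
      · exact .inr (.inl h)
      · have := key a b hab h
        tauto
      · have := key b a hab.symm h
        tauto
  · rintro ⟨h1, h2, h3, h4, h5, h6, h7⟩
    have hvc : ¬M.Covers v := h4 v (by simp [relabel])
    refine ⟨⟨⟨hr.2 h1.rooted, fun a b ha hab => ?_⟩, h2.trans le_sup_left, h3, fun a ha => ?_,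
      fun a ha => ?_, fun a ha => ?_, fun a b hab => ?_⟩, fun w => ⟨?_, fun hw => ⟨?_, ?_⟩⟩⟩
    · have hav : a ≠ v := by rintro rfl; simp [hv] at ha
      rcases hab with hab | hab
      · exact h1.not_adj_of_dead a b ((hts a hav (by simp [ha])).trans ha) hab
      · rw [SimpleGraph.starOn_adj hv'] at hab
        exact hab.elim (fun h => hav h.1) (fun h => hne a (by simp [ha]) h.2)
    · have hav : a ≠ v := by rintro rfl; simp [hv] at ha
      exact h4 a ((hts a hav (by simp [ha])).trans ha)
    · by_cases hav : a = v
      · exact hav ▸ hvc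
      · exact h5 a ((hts a hav (by simp [ha])).trans ha)
    · have hav : a ≠ v := by rintro rfl; simp [hv] at ha
      exact h6 a ((hts a hav (by simp [ha])).trans ha)
    · rcases hab with hab | hab
      · exact (h7 a b hab).imp_right (Or.imp_right
          (Or.imp (hst _ (by simp) a) (hst _ (by simp) b)))
      · rw [SimpleGraph.starOn_adj hv'] at hab
        rcases hab with ⟨rfl, -⟩ | ⟨rfl, -⟩
        · exact .inr (.inr (.inl hv))
        · exact .inr (.inr (.inr hv))
    · rintro ⟨hvw | hvw, hw⟩
      · rcases h7 v w hvw with h | h | h | h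
        · exact absurd h hvc
        · exact absurd h hw
        · simp [relabel] at h
        · exact absurd hvw (h1.eq_of_adj_roots (by simp [relabel]) (by simp [h]))
      · rw [SimpleGraph.starOn_adj hv'] at hvw
        exact hvw.elim And.right fun h => absurd h.2 hv'
    · exact .inr ((SimpleGraph.starOn_adj hv').2 (.inl ⟨rfl, hw⟩))
    · exact h4 w (by simp [relabel, hw])

theorem isCompatibleMatching_remove_matched_edge {w : V} (hv : σ v = matchedInside)
    (hw : σ w = free) (hG : ¬G.Adj v w) (hM : ¬M.Adj v w) :
    IsCompatibleMatching σ (G ⊔ SimpleGraph.starOn v {w}, M ⊔ SimpleGraph.starOn v {w}) ↔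
      IsCompatibleMatching (relabel σ v matchedOutside {w} matchedOutside) (G, M) := by
  classical
  have hv' : v ∉ ({w} : Finset V) := fun h => by
    simp [(Finset.mem_singleton.1 h ▸ hv : σ w = matchedInside)] at hw
  have hvw : v ≠ w := by simpa using hv'
  have hr := isRootedForest_relabel (G := G) (by simp [hv] : σ v ≠ free)
    (J := {w}) (by simpa using hw) (s := matchedOutside)
    (t := matchedOutside) (by simp) (by simp) (by simpa using hG)
  have hadj : ∀ a b, (SimpleGraph.starOn v {w}).Adj a b ↔ (a = v ∧ b = w) ∨ (b = v ∧ a = w) := by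
    intro a b
    rw [SimpleGraph.starOn_adj hv']
    simp
  have hst : ∀ t, t ≠ matchedOutside → ∀ a,
      relabel σ v matchedOutside {w} matchedOutside a = t → a ≠ v ∧ a ≠ w ∧ σ a = t := by
    intro t ht a ha
    simp only [relabel, Finset.mem_singleton] at ha
    grind
  have hts : ∀ a, a ≠ v → a ≠ w → relabel σ v matchedOutside {w} matchedOutside a = σ a := by
    intro a hav haw
    simp [relabel, hav, haw]
  have hcov : ∀ a, a ≠ v → a ≠ w → ((M ⊔ SimpleGraph.starOn v {w}).Covers a ↔ M.Covers a) := by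
    intro a hav haw
    simp only [SimpleGraph.Covers, SimpleGraph.sup_adj, hadj]
    simp [hav, haw]
  have hcv : (M ⊔ SimpleGraph.starOn v {w}).Covers v := ⟨w, .inr ((hadj _ _).2 (.inl ⟨rfl, rfl⟩))⟩
  have hcw : (M ⊔ SimpleGraph.starOn v {w}).Covers w := ⟨v, .inr ((hadj _ _).2 (.inr ⟨rfl, rfl⟩))⟩
  have hnew : relabel σ v matchedOutside {w} matchedOutside v = matchedOutside := by simp [relabel]
  have hnew' : relabel σ v matchedOutside {w} matchedOutside w = matchedOutside := by
    simp [relabel]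
  constructor
  · rintro ⟨h1, h2, h3, h4, h5, h6, h7⟩
    refine ⟨⟨hr.1 h1.rooted, fun a b ha hab => h1.not_adj_of_dead a b (hst _ (by simp) a ha).2.2
      (.inl hab)⟩, fun a b hab => ?_, fun a b c hab hac => h3 a b c (.inl hab) (.inl hac),
      fun a ha => ?_, fun a ha => ?_, fun a ha => ?_, fun a b hab => ?_⟩
    · rcases h2 (.inl hab) with h | h
      · exact h
      · rw [hadj] at h
        rcases h with ⟨rfl, rfl⟩ | ⟨rfl, rfl⟩
        · exact absurd hab hM
        · exact absurd hab.symm hM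
    · obtain ⟨hav, haw, ha⟩ := hst _ (by simp) a ha
      exact fun h => h4 a ha ((hcov a hav haw).2 h)
    · rintro ⟨b, hb⟩
      by_cases hav : a = v
      · subst hav
        have := h3 a b w (.inl hb) (.inr ((hadj _ _).2 (.inl ⟨rfl, rfl⟩)))
        exact hM (this ▸ hb)
      · by_cases haw : a = w
        · subst haw
          have := h3 a b v (.inl hb) (.inr ((hadj _ _).2 (.inr ⟨rfl, rfl⟩)))
          exact hM (this ▸ hb.symm)
        · exact h5 a ((hts a hav haw).symm.trans ha) ((hcov a hav haw).2 ⟨b, hb⟩)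
    · obtain ⟨hav, haw, ha⟩ := hst _ (by simp) a ha
      exact (hcov a hav haw).1 (h6 a ha)
    · have key : ∀ a, (M ⊔ SimpleGraph.starOn v {w}).Covers a → M.Covers a ∨
          relabel σ v matchedOutside {w} matchedOutside a = matchedOutside := by
        intro a ha
        by_cases hav : a = v
        · exact .inr (hav ▸ hnew)
        · by_cases haw : a = w
          · exact .inr (haw ▸ hnew')
          · exact .inl ((hcov a hav haw).1 ha)
      have key' : ∀ a, σ a = matchedOutside →
          relabel σ v matchedOutside {w} matchedOutside a = matchedOutside := by
        intro a ha
        have hav : a ≠ v := by rintro rfl; simp [hv] at ha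
        have haw : a ≠ w := by rintro rfl; simp [hw] at ha
        exact (hts a hav haw).trans ha
      rcases h7 a b (.inl hab) with h | h | h | h
      · exact (key a h).imp_right fun h => .inr (.inl h)
      · exact .inr ((key b h).imp_right .inr)
      · exact .inr (.inr (.inl (key' a h)))
      · exact .inr (.inr (.inr (key' b h)))
  · rintro ⟨h1, h2, h3, h4, h5, h6, h7⟩
    have hMv : ∀ b, ¬M.Adj v b := fun b hb => h5 v hnew ⟨b, hb⟩
    have hMw : ∀ b, ¬M.Adj w b := fun b hb => h5 w hnew' ⟨b, hb⟩
    refine ⟨⟨hr.2 h1.rooted, fun a b ha hab => ?_⟩, sup_le_sup_right h2 _, fun a b c hab hac => ?_,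
      fun a ha => ?_, fun a ha => ?_, fun a ha => ?_, fun a b hab => ?_⟩
    · have hav : a ≠ v := by rintro rfl; simp [hv] at ha
      have haw : a ≠ w := by rintro rfl; simp [hw] at ha
      rcases hab with hab | hab
      · exact h1.not_adj_of_dead a b ((hts a hav haw).trans ha) hab
      · rw [hadj] at hab
        grind
    · dsimp only at hab hac
      rw [SimpleGraph.sup_adj, hadj] at hab hac
      have := h3 a b c
      have := hMv b
      have := hMv c
      have := hMw b
      have := hMw c
      grind
    · have hav : a ≠ v := by rintro rfl; simp [hv] at ha
      have haw : a ≠ w := by rintro rfl; simp [hw] at ha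
      exact fun h => h4 a ((hts a hav haw).trans ha) ((hcov a hav haw).1 h)
    · have hav : a ≠ v := by rintro rfl; simp [hv] at ha
      have haw : a ≠ w := by rintro rfl; simp [hw] at ha
      exact fun h => h5 a ((hts a hav haw).trans ha) ((hcov a hav haw).1 h)
    · by_cases hav : a = v
      · exact hav ▸ hcv
      · have haw : a ≠ w := by rintro rfl; simp [hw] at ha
        exact (hcov a hav haw).2 (h6 a ((hts a hav haw).trans ha))
    · rcases hab with hab | hab
      · have key : ∀ a, M.Covers a → (M ⊔ SimpleGraph.starOn v {w}).Covers a :=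
          fun a ⟨b, hb⟩ => ⟨b, .inl hb⟩
        have key' : ∀ a, relabel σ v matchedOutside {w} matchedOutside a = matchedOutside →
            (M ⊔ SimpleGraph.starOn v {w}).Covers a ∨ σ a = matchedOutside := by
          intro a ha
          by_cases hav : a = v
          · exact .inl (hav ▸ hcv)
          · by_cases haw : a = w
            · exact .inl (haw ▸ hcw)
            · exact .inr ((hts a hav haw).symm.trans ha)
        rcases h7 a b hab with h | h | h | h
        · exact .inl (key a h)
        · exact .inr (.inl (key b h))
        · exact (key' a h).imp_right fun h => .inr (.inl h)
        · exact .inr ((key' b h).imp_right .inr)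
      · rw [hadj] at hab
        rcases hab with ⟨rfl, rfl⟩ | ⟨rfl, rfl⟩
        · exact .inl hcv
        · exact .inl hcw

end Moves

section Counting

variable {V : Type*} {σ : V → VertexStatus} {v : V}

theorem SimpleGraph.starOn_le {J : Finset V} {G : SimpleGraph V} (h : ∀ w ∈ J, G.Adj v w) :
    SimpleGraph.starOn v J ≤ G := by
  intro a b hab
  simp only [SimpleGraph.starOn, SimpleGraph.fromRel_adj] at hab
  rcases hab with ⟨-, ⟨rfl, hb⟩ | ⟨rfl, ha⟩⟩
  exacts [h b hb, (h a ha).symm]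

theorem SimpleGraph.disjoint_starOn {J : Finset V} {G : SimpleGraph V} (hv : v ∉ J) :
    Disjoint G (SimpleGraph.starOn v J) ↔ ∀ w ∈ J, ¬G.Adj v w := by
  rw [SimpleGraph.disjoint_left]
  simp only [SimpleGraph.starOn_adj hv]
  exact ⟨fun h w hw hvw => h v w hvw (.inl ⟨rfl, hw⟩), fun h a b hab => by
    rintro (⟨rfl, hb⟩ | ⟨rfl, ha⟩)
    exacts [h b hb hab, h a ha hab.symm]⟩

theorem IsCompatibleForest.not_adj_relabel {J : Finset V} {s t : VertexStatus}
    {G : SimpleGraph V} (h : IsCompatibleForest (relabel σ v s J t) G) (hs : s ≠ free)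
    (ht : t ≠ free) : ∀ w ∈ J, ¬G.Adj v w := by
  intro w hw
  by_cases hwv : w = v
  · exact hwv ▸ G.irrefl
  · exact h.eq_of_adj_roots (by simpa [relabel]) (by simpa [relabel, hwv, hw])

open Classical in
theorem card_isCompatibleForest_root [Fintype V] {t : VertexStatus} (hv : σ v ≠ free)
    (hd : σ v ≠ dead) (ht : t ≠ free) (htd : t ≠ dead) :
    Nat.card {G // IsCompatibleForest σ G} =
      ∑ J ∈ (Finset.univ.filter fun a => σ a = free).powerset,
        Nat.card {G // IsCompatibleForest (relabel σ v dead J t) G} := by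
  rw [Nat.card_subtype_eq_sum (R := fun (G : SimpleGraph V) (J : Finset V) => ∀ w, G.Adj v w ↔ w ∈ J)
    (Finset.univ.filter fun a => σ a = free).powerset]
  · refine Finset.sum_congr rfl fun J hJ => ?_
    have hJ : ∀ w ∈ J, σ w = free := fun w hw => by
      simpa using Finset.mem_powerset.1 hJ hw
    have hvJ : v ∉ J := fun h => hv (hJ v h)
    refine Nat.card_subtype_eq_of_sup (SimpleGraph.starOn v J)
      (fun G hG => SimpleGraph.starOn_le fun w hw => (hG.2 w).2 hw)
      (fun G hG => (SimpleGraph.disjoint_starOn hvJ).2 (hG.not_adj_relabel (by simp) ht))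
      (fun G hG => isCompatibleForest_remove_root hv hd hJ ht htd
        ((SimpleGraph.disjoint_starOn hvJ).1 hG))
  · intro G hG
    refine ⟨Finset.univ.filter fun w => G.Adj v w, ⟨?_, by simp⟩, ?_⟩
    · rw [Finset.mem_powerset]
      intro w hw
      simp only [Finset.mem_filter, Finset.mem_univ, true_and] at hw ⊢
      by_contra hwf
      exact hG.eq_of_adj_roots hv hwf hw
    · rintro J ⟨-, hJ⟩
      ext w
      simp [hJ]

open Classical in
theorem card_isCompatibleMatching_unmatched [Fintype V] (hv : σ v = unmatched) :
    Nat.card {x // IsCompatibleMatching σ x} =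
      ∑ J ∈ (Finset.univ.filter fun a => σ a = free).powerset,
        Nat.card {x // IsCompatibleMatching (relabel σ v dead J matchedInside) x} := by
  rw [Nat.card_subtype_eq_sum (R := fun (x : SimpleGraph V × SimpleGraph V) (J : Finset V) =>
    ∀ w, x.1.Adj v w ↔ w ∈ J) (Finset.univ.filter fun a => σ a = free).powerset]
  · refine Finset.sum_congr rfl fun J hJ => ?_
    have hJ : ∀ w ∈ J, σ w = free := fun w hw => by
      simpa using Finset.mem_powerset.1 hJ hw
    have hvJ : v ∉ J := fun h => by simp [hJ v h] at hv
    refine Nat.card_subtype_eq_of_sup (SimpleGraph.starOn v J, ⊥)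
      (fun x hx => Prod.le_def.2 ⟨SimpleGraph.starOn_le fun w hw => (hx.2 w).2 hw, bot_le⟩)
      (fun x hx => Prod.disjoint_iff.2 ⟨(SimpleGraph.disjoint_starOn hvJ).2
        (hx.forest.not_adj_relabel (by simp) (by simp)), disjoint_bot_right⟩)
      (fun x hx => ?_)
    have := isCompatibleMatching_remove_unmatched (M := x.2) hv hJ
      ((SimpleGraph.disjoint_starOn hvJ).1 (Prod.disjoint_iff.1 hx).1)
    simpa [Prod.sup_def] using this
  · intro x hx
    refine ⟨Finset.univ.filter fun w => x.1.Adj v w, ⟨?_, by simp⟩, ?_⟩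
    · rw [Finset.mem_powerset]
      intro w hw
      simp only [Finset.mem_filter, Finset.mem_univ, true_and] at hw ⊢
      by_contra hwf
      exact hx.forest.eq_of_adj_roots (by simp [hv]) hwf hw
    · rintro J ⟨-, hJ⟩
      ext w
      simp [hJ]

open Classical in
theorem card_isCompatibleMatching_matchedOutside [Fintype V] (hv : σ v = matchedOutside) :
    Nat.card {x // IsCompatibleMatching σ x} =
      ∑ J ∈ (Finset.univ.filter fun a => σ a = free).powerset,
        Nat.card {x // IsCompatibleMatching (relabel σ v unmatched J unmatched) x} := by
  rw [Nat.card_subtype_eq_sum (R := fun (x : SimpleGraph V × SimpleGraph V) (J : Finset V) =>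
    ∀ w, (x.1.Adj v w ∧ ¬x.2.Covers w) ↔ w ∈ J) (Finset.univ.filter fun a => σ a = free).powerset]
  · refine Finset.sum_congr rfl fun J hJ => ?_
    have hJ : ∀ w ∈ J, σ w = free := fun w hw => by
      simpa using Finset.mem_powerset.1 hJ hw
    have hvJ : v ∉ J := fun h => by simp [hJ v h] at hv
    refine Nat.card_subtype_eq_of_sup (SimpleGraph.starOn v J, ⊥)
      (fun x hx => Prod.le_def.2 ⟨SimpleGraph.starOn_le fun w hw => ((hx.2 w).2 hw).1, bot_le⟩)
      (fun x hx => Prod.disjoint_iff.2 ⟨(SimpleGraph.disjoint_starOn hvJ).2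
        (hx.forest.not_adj_relabel (by simp) (by simp)), disjoint_bot_right⟩)
      (fun x hx => ?_)
    have := isCompatibleMatching_release_matchedOutside (M := x.2) hv hJ
      ((SimpleGraph.disjoint_starOn hvJ).1 (Prod.disjoint_iff.1 hx).1)
    simpa [Prod.sup_def] using this
  · intro x hx
    refine ⟨Finset.univ.filter fun w => x.1.Adj v w ∧ ¬x.2.Covers w, ⟨?_, by simp⟩, ?_⟩
    · rw [Finset.mem_powerset]
      intro w hw
      simp only [Finset.mem_filter, Finset.mem_univ, true_and] at hw ⊢
      by_contra hwf
      exact hx.forest.eq_of_adj_roots (by simp [hv]) hwf hw.1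
    · rintro J ⟨-, hJ⟩
      ext w
      simp [hJ]

open Classical in
theorem card_isCompatibleMatching_matchedInside [Fintype V] (hv : σ v = matchedInside) :
    Nat.card {x // IsCompatibleMatching σ x} =
      ∑ w ∈ Finset.univ.filter fun a => σ a = free,
        Nat.card {x // IsCompatibleMatching (relabel σ v matchedOutside {w} matchedOutside) x} := by
  rw [Nat.card_subtype_eq_sum (R := fun (x : SimpleGraph V × SimpleGraph V) (w : V) =>
    x.2.Adj v w) (Finset.univ.filter fun a => σ a = free)]
  · refine Finset.sum_congr rfl fun w hw => ?_
    have hw : σ w = free := by simpa using hw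
    have hvw : v ∉ ({w} : Finset V) := fun h => by
      simp [(Finset.mem_singleton.1 h ▸ hv : σ w = matchedInside)] at hw
    have hself : (SimpleGraph.starOn v {w}).Adj v w :=
      (SimpleGraph.starOn_adj hvw).2 (.inl ⟨rfl, Finset.mem_singleton_self w⟩)
    refine Nat.card_subtype_eq_of_sup (SimpleGraph.starOn v {w}, SimpleGraph.starOn v {w})
      (fun x hx => ?_) (fun x hx => ?_) (fun x hx => ?_)
    · have := SimpleGraph.starOn_le (J := {w}) (G := x.2) (v := v) (by simpa using hx.2)
      exact ⟨this.trans hx.1.le, this⟩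
    · have := (SimpleGraph.disjoint_starOn hvw).2
        (hx.forest.not_adj_relabel (by simp) (by simp))
      exact Prod.disjoint_iff.2 ⟨this, this.mono_left hx.le⟩
    · obtain ⟨h1, h2⟩ := Prod.disjoint_iff.1 hx
      have := isCompatibleMatching_remove_matched_edge (G := x.1) (M := x.2) hv hw
        ((SimpleGraph.disjoint_starOn hvw).1 h1 w (by simp))
        ((SimpleGraph.disjoint_starOn hvw).1 h2 w (by simp))
      rw [← this]
      exact and_iff_left (Or.inr hself)
  · intro x hx
    obtain ⟨w, hw⟩ := hx.covers_matchedInside v hv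
    refine ⟨w, ⟨?_, hw⟩, fun u hu => hx.eq_of_adj v u w hu.2 hw⟩
    simp only [Finset.mem_filter, Finset.mem_univ, true_and]
    by_contra hwf
    exact hx.forest.eq_of_adj_roots (by simp [hv]) hwf (hx.le hw)

theorem isCompatibleForest_relabel_free {s : VertexStatus} (hsd : s ≠ dead)
    (hv : σ v = free) (hσ : ∀ a, σ a = free ∨ σ a = dead) (G : SimpleGraph V) :
    IsCompatibleForest (relabel σ v s ∅ s) G ↔ IsCompatibleForest σ G := by
  have hd : ∀ a, relabel σ v s ∅ s a = dead ↔ σ a = dead := by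
    intro a
    simp only [relabel, Finset.notMem_empty, if_false]
    split_ifs with h
    · simp [h, hv, hsd]
    · rfl
  have hiso : ∀ a b, (∀ c, ¬G.Adj a c) → G.Reachable a b → a = b := by
    rintro a b h ⟨p⟩
    cases p with
    | nil => rfl
    | cons hac p => exact absurd hac (h _)
  constructor
  · rintro ⟨h1, h2⟩
    have h2' : ∀ a b, σ a = dead → ¬G.Adj a b := fun a b ha => h2 a b ((hd a).2 ha)
    exact ⟨⟨h1.1, fun a ha b _ => hiso a b fun c => h2' a c ((hσ a).resolve_left ha)⟩, h2'⟩
  · rintro ⟨h1, h2⟩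
    refine ⟨⟨h1.1, fun a ha b hb hab => ?_⟩, fun a b ha => h2 a b ((hd a).1 ha)⟩
    rcases hσ a with ha' | ha'
    · rcases hσ b with hb' | hb'
      · have key : ∀ a, relabel σ v s ∅ s a ≠ free → σ a = free → a = v := by
          intro a h h'
          by_contra hav
          exact h (by simp [relabel, hav, h'])
        rw [key a ha ha', key b hb hb']
      · exact (hiso b a (fun c => h2 b c hb') hab.symm).symm
    · exact hiso a b (fun c => h2 a c ha') hab

theorem isCompatibleMatching_relabel_free {s : VertexStatus}
    (hs : s = unmatched ∨ s = matchedInside) (hv : σ v = free)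
    (hσ : ∀ a, σ a = free ∨ σ a = dead) (x : SimpleGraph V × SimpleGraph V) :
    IsCompatibleMatching (relabel σ v s ∅ s) x ↔
      IsCompatibleMatching σ x ∧ (s = matchedInside ↔ x.2.Covers v) := by
  have hF := isCompatibleForest_relabel_free (s := s) (by rcases hs with rfl | rfl <;> simp) hv hσ x.1
  have hne : ∀ a, σ a ≠ unmatched ∧ σ a ≠ matchedOutside ∧ σ a ≠ matchedInside := by
    intro a
    rcases hσ a with h | h <;> simp [h]
  have hrv : relabel σ v s ∅ s v = s := by simp [relabel]
  have hr : ∀ a, a ≠ v → relabel σ v s ∅ s a = σ a := by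
    intro a ha
    simp [relabel, ha]
  have ho : ∀ a, relabel σ v s ∅ s a ≠ matchedOutside := by
    intro a
    by_cases h : a = v
    · rw [h, hrv]
      rcases hs with rfl | rfl <;> simp
    · rw [hr a h]
      exact (hne a).2.1
  constructor
  · rintro ⟨h1, h2, h3, h4, h5, h6, h7⟩
    refine ⟨⟨hF.1 h1, h2, h3, fun a ha => absurd ha (hne a).1, fun a ha => absurd ha (hne a).2.1,
      fun a ha => absurd ha (hne a).2.2, fun a b hab => ?_⟩, fun h => h6 v (hrv.trans h), fun h => ?_⟩
    · have := h7 a b hab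
      simpa [ho, hne] using this
    · rcases hs with rfl | rfl
      · exact absurd h (h4 v hrv)
      · rfl
  · rintro ⟨⟨h1, h2, h3, -, -, -, h7⟩, h8⟩
    refine ⟨hF.2 h1, h2, h3, fun a ha => ?_, fun a ha => absurd ha (ho a), fun a ha => ?_,
      fun a b hab => ?_⟩
    · by_cases h : a = v
      · subst h
        rw [hrv] at ha
        rw [← h8, ha]
        simp
      · exact absurd ((hr a h).symm.trans ha) (hne a).1
    · by_cases h : a = v
      · subst h
        rw [hrv] at ha
        exact h8.1 ha
      · exact absurd ((hr a h).symm.trans ha) (hne a).2.2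
    · have := h7 a b hab
      simpa [ho, hne] using this

theorem card_isCompatibleMatching_free [Finite V] (hv : σ v = free)
    (hσ : ∀ a, σ a = free ∨ σ a = dead) :
    Nat.card {x // IsCompatibleMatching σ x} =
      Nat.card {x // IsCompatibleMatching (relabel σ v unmatched ∅ unmatched) x} +
        Nat.card {x // IsCompatibleMatching (relabel σ v matchedInside ∅ matchedInside) x} := by
  rw [Nat.card_subtype_eq_sum (ι := Prop) (R := fun (x : SimpleGraph V × SimpleGraph V) (b : Prop) =>
    b = x.2.Covers v) {False, True}]
  · rw [Finset.sum_pair (by simp)]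
    congr 1 <;> refine Nat.card_congr (Equiv.subtypeEquivRight fun x => ?_)
    · rw [isCompatibleMatching_relabel_free (.inl rfl) hv hσ]
      simp
    · rw [isCompatibleMatching_relabel_free (.inr rfl) hv hσ]
      simp
  · intro x hx
    refine ⟨_, ⟨?_, rfl⟩, fun _ h => h.2⟩
    by_cases h : x.2.Covers v <;> simp [h]

theorem isCompatibleForest_dead (hσ : ∀ a, σ a = dead) (G : SimpleGraph V) :
    IsCompatibleForest σ G ↔ G = ⊥ := by
  constructor
  · intro h
    ext a b
    simpa using h.not_adj_of_dead a b (hσ a)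
  · rintro rfl
    exact ⟨⟨SimpleGraph.isAcyclic_bot, by simp⟩, by simp⟩

theorem isCompatibleMatching_dead (hσ : ∀ a, σ a = dead) (x : SimpleGraph V × SimpleGraph V) :
    IsCompatibleMatching σ x ↔ x = ⊥ := by
  constructor
  · intro h
    have h1 := (isCompatibleForest_dead hσ _).1 h.forest
    exact Prod.ext h1 (le_bot_iff.1 (h.le.trans_eq h1))
  · rintro rfl
    exact ⟨(isCompatibleForest_dead hσ _).2 rfl, le_rfl, by simp, by simp [hσ], by simp [hσ],
      by simp [hσ], by simp⟩

end Counting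

section Evaluation

variable {V : Type*} [Fintype V]

theorem card_isCompatibleMatching {s : ℝ} (hs : 0 < s) (σ : V → VertexStatus) :
    (Nat.card {x // IsCompatibleMatching σ x} : ℂ) =
      matchingCoeff s (count σ free) (count σ unmatched) (count σ matchedOutside)
        (count σ matchedInside) := by
  classical
  induction hN : ∑ a, (σ a).weight using Nat.strong_induction_on generalizing σ with
  | _ N ih =>
  subst hN
  have hfree : ∀ J ∈ (Finset.univ.filter fun a => σ a = free).powerset, ∀ w ∈ J, σ w = free :=
    fun J hJ w hw => by simpa using Finset.mem_powerset.1 hJ hw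
  have hcard : (Finset.univ.filter fun a => σ a = free).card = count σ free :=
    card_filter_eq_count σ free
  by_cases hU : ∃ v, σ v = unmatched
  · obtain ⟨v, hv⟩ := hU
    obtain ⟨u, hu⟩ : ∃ u, count σ unmatched = u + 1 :=
      Nat.exists_eq_succ_of_ne_zero fun h => count_eq_zero.1 h v hv
    have key : ∀ J ∈ (Finset.univ.filter fun a => σ a = free).powerset,
        (Nat.card {x // IsCompatibleMatching (relabel σ v dead J matchedInside) x} : ℂ) =
        matchingCoeff s (count σ free - J.card) u (count σ matchedOutside)
          (count σ matchedInside + J.card) := by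
      intro J hJ
      have hJ := hfree J hJ
      rw [ih _ (sum_weight_relabel_lt hJ (by simp [hv, weight])) _ rfl]
      have hc := count_relabel dead matchedInside (fun h => by simp [hJ v h] at hv : v ∉ J) hJ
      have h1 := hc free
      have h2 := hc unmatched
      have h3 := hc matchedOutside
      have h4 := hc matchedInside
      simp [hv] at h1 h2 h3 h4
      congr 1 <;> lia
    rw [card_isCompatibleMatching_unmatched hv, Nat.cast_sum, Finset.sum_congr rfl key,
      Finset.sum_powerset_apply_card (fun l => matchingCoeff s (count σ free - l) u
        (count σ matchedOutside) (count σ matchedInside + l)), hcard, hu, matchingCoeff_unmatched hs]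
  by_cases hH : ∃ v, σ v = matchedOutside
  · obtain ⟨v, hv⟩ := hH
    obtain ⟨h, hh⟩ : ∃ h, count σ matchedOutside = h + 1 :=
      Nat.exists_eq_succ_of_ne_zero fun h => count_eq_zero.1 h v hv
    have key : ∀ J ∈ (Finset.univ.filter fun a => σ a = free).powerset,
        (Nat.card {x // IsCompatibleMatching (relabel σ v unmatched J unmatched) x} : ℂ) =
        matchingCoeff s (count σ free - J.card) (count σ unmatched + 1 + J.card) h
          (count σ matchedInside) := by
      intro J hJ
      have hJ := hfree J hJ
      rw [ih _ (sum_weight_relabel_lt hJ (by simp [hv, weight])) _ rfl]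
      have hc := count_relabel unmatched unmatched (fun h => by simp [hJ v h] at hv : v ∉ J) hJ
      have h1 := hc free
      have h2 := hc unmatched
      have h3 := hc matchedOutside
      have h4 := hc matchedInside
      simp [hv] at h1 h2 h3 h4
      congr 1 <;> lia
    rw [card_isCompatibleMatching_matchedOutside hv, Nat.cast_sum, Finset.sum_congr rfl key,
      Finset.sum_powerset_apply_card (fun l => matchingCoeff s (count σ free - l)
        (count σ unmatched + 1 + l) h (count σ matchedInside)), hcard, hh, matchingCoeff_half hs]
  by_cases hP : ∃ v, σ v = matchedInside
  · obtain ⟨v, hv⟩ := hP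
    obtain ⟨p, hp⟩ : ∃ p, count σ matchedInside = p + 1 :=
      Nat.exists_eq_succ_of_ne_zero fun h => count_eq_zero.1 h v hv
    have key : ∀ w ∈ Finset.univ.filter fun a => σ a = free,
        (Nat.card {x // IsCompatibleMatching (relabel σ v matchedOutside {w} matchedOutside) x} : ℂ)
        = matchingCoeff s (count σ free - 1) (count σ unmatched) (count σ matchedOutside + 2) p := by
      intro w hw
      have hw : σ w = free := by simpa using hw
      have hJ : ∀ a ∈ ({w} : Finset V), σ a = free := by simpa using hw
      rw [ih _ (sum_weight_relabel_lt hJ (by simp [hv, weight])) _ rfl]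
      have hc := count_relabel matchedOutside matchedOutside
        (fun h => by simp [hJ v h] at hv : v ∉ ({w} : Finset V)) hJ
      have h1 := hc free
      have h2 := hc unmatched
      have h3 := hc matchedOutside
      have h4 := hc matchedInside
      simp [hv] at h1 h2 h3 h4
      congr 1 <;> lia
    rw [card_isCompatibleMatching_matchedInside hv, Nat.cast_sum, Finset.sum_congr rfl key,
      Finset.sum_const, hcard, hp]
    cases hm : count σ free with
    | zero => rw [zero_smul, matchingCoeff_zero_matched hs]
    | succ m =>
      rw [matchingCoeff_succ_matched hs, nsmul_eq_mul]
      push_cast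
      rfl
  have hσ : ∀ a, σ a = free ∨ σ a = dead := by
    intro a
    have h1 := not_exists.1 hU a
    have h2 := not_exists.1 hH a
    have h3 := not_exists.1 hP a
    generalize σ a = t at h1 h2 h3
    cases t <;> simp at *
  have hU0 : count σ unmatched = 0 := count_eq_zero.2 (not_exists.1 hU)
  have hH0 : count σ matchedOutside = 0 := count_eq_zero.2 (not_exists.1 hH)
  have hP0 : count σ matchedInside = 0 := count_eq_zero.2 (not_exists.1 hP)
  by_cases hF : ∃ v, σ v = free
  · obtain ⟨v, hv⟩ := hF
    obtain ⟨m, hm⟩ : ∃ m, count σ free = m + 1 :=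
      Nat.exists_eq_succ_of_ne_zero fun h => count_eq_zero.1 h v hv
    have key : ∀ t : VertexStatus, t.weight < 4 →
        (Nat.card {x // IsCompatibleMatching (relabel σ v t ∅ t) x} : ℂ) =
        matchingCoeff s (m + if t = free then 1 else 0) (if t = unmatched then 1 else 0)
          (if t = matchedOutside then 1 else 0) (if t = matchedInside then 1 else 0) := by
      intro t ht
      rw [ih _ (sum_weight_relabel_lt (by simp) (by simpa [hv, weight] using ht)) _ rfl]
      have hc := count_relabel (σ := σ) (v := v) (J := ∅) t t (by simp) (by simp)
      have h1 := hc free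
      have h2 := hc unmatched
      have h3 := hc matchedOutside
      have h4 := hc matchedInside
      simp [hv, hm, hU0, hH0, hP0] at h1 h2 h3 h4
      congr 1
      lia
    rw [card_isCompatibleMatching_free hv hσ, Nat.cast_add, key _ (by simp [weight]),
      key _ (by simp [weight]), hU0, hH0, hP0, hm, matchingCoeff_no_roots hs]
    simp
  · have hd : ∀ a, σ a = dead := fun a => (hσ a).resolve_left (not_exists.1 hF a)
    have hF0 : count σ free = 0 := count_eq_zero.2 (not_exists.1 hF)
    rw [hU0, hH0, hP0, hF0, matchingCoeff_zero hs]
    simp [isCompatibleMatching_dead hd]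

theorem card_isCompatibleForest {s : ℝ} (hs : 0 < s) (σ : V → VertexStatus)
    (hσ : ∀ a, σ a = free ∨ σ a = dead ∨ σ a = unmatched) :
    (Nat.card {G // IsCompatibleForest σ G} : ℂ) =
      forestCoeff s (count σ free) (count σ unmatched) := by
  classical
  induction hN : ∑ a, (σ a).weight using Nat.strong_induction_on generalizing σ with
  | _ N ih =>
  subst hN
  have hrel : ∀ v t J, (t = free ∨ t = dead ∨ t = unmatched) → ∀ a,
      relabel σ v t J unmatched a = free ∨ relabel σ v t J unmatched a = dead ∨
        relabel σ v t J unmatched a = unmatched := by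
    intro v t J ht a
    simp only [relabel]
    split_ifs
    exacts [ht, .inr (.inr rfl), hσ a]
  by_cases hU : ∃ v, σ v = unmatched
  · obtain ⟨v, hv⟩ := hU
    obtain ⟨u, hu⟩ : ∃ u, count σ unmatched = u + 1 :=
      Nat.exists_eq_succ_of_ne_zero fun h => count_eq_zero.1 h v hv
    have key : ∀ J ∈ (Finset.univ.filter fun a => σ a = free).powerset,
        (Nat.card {G // IsCompatibleForest (relabel σ v dead J unmatched) G} : ℂ) =
        forestCoeff s (count σ free - J.card) (u + J.card) := by
      intro J hJ
      have hJ : ∀ w ∈ J, σ w = free := fun w hw => by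
        simpa using Finset.mem_powerset.1 hJ hw
      rw [ih _ (sum_weight_relabel_lt hJ (by simp [hv, weight])) _
        (hrel v dead J (.inr (.inl rfl))) rfl]
      have hc := count_relabel dead unmatched (fun h => by simp [hJ v h] at hv : v ∉ J) hJ
      have h1 := hc free
      have h2 := hc unmatched
      simp [hv] at h1 h2
      congr 1 <;> lia
    rw [card_isCompatibleForest_root (v := v) (t := unmatched) (by simp [hv]) (by simp [hv]) (by simp)
      (by simp), Nat.cast_sum, Finset.sum_congr rfl key, Finset.sum_powerset_apply_card
      (fun l => forestCoeff s (count σ free - l) (u + l)), card_filter_eq_count, hu,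
      forestCoeff_succ hs]
  have hU0 : count σ unmatched = 0 := count_eq_zero.2 (not_exists.1 hU)
  have hσ' : ∀ a, σ a = free ∨ σ a = dead := fun a =>
    (hσ a).imp_right fun h => h.resolve_right (not_exists.1 hU a)
  by_cases hF : ∃ v, σ v = free
  · obtain ⟨v, hv⟩ := hF
    obtain ⟨m, hm⟩ : ∃ m, count σ free = m + 1 :=
      Nat.exists_eq_succ_of_ne_zero fun h => count_eq_zero.1 h v hv
    have hc := count_relabel (σ := σ) (v := v) (J := ∅) unmatched unmatched (by simp) (by simp)
    have h1 := hc free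
    have h2 := hc unmatched
    simp [hv, hm, hU0] at h1 h2
    have := ih _ (sum_weight_relabel_lt (v := v) (J := ∅) (s := unmatched) (t := unmatched)
      (by simp) (by simp [hv, weight])) _ (hrel v _ ∅ (.inr (.inr rfl))) rfl
    simp only [isCompatibleForest_relabel_free (s := unmatched) (by simp) hv hσ', h1, h2] at this
    rw [this, hm, hU0, forestCoeff_no_roots hs]
  · have hd : ∀ a, σ a = dead := fun a => (hσ' a).resolve_left (not_exists.1 hF a)
    have hF0 : count σ free = 0 := count_eq_zero.2 (not_exists.1 hF)
    rw [hU0, hF0, forestCoeff_zero hs]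
    simp [isCompatibleForest_dead hd]

end Evaluation

theorem isMatching_edgeSet {V : Type*} {G M : SimpleGraph V} :
    IsMatching G M.edgeSet ↔ M ≤ G ∧ ∀ a b c, M.Adj a b → M.Adj a c → b = c := by
  refine and_congr SimpleGraph.edgeSet_subset_edgeSet ⟨fun h a b c hb hc => ?_, fun h => ?_⟩
  · by_contra hbc
    refine h s(a, b) hb s(a, c) hc (fun he => hbc ?_) a (Sym2.mem_mk_left _ _) (Sym2.mem_mk_left _ _)
    exact Sym2.congr_right.1 he
  · intro e he f hf hef v hve hvf
    obtain ⟨b, rfl⟩ := hve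
    obtain ⟨c, rfl⟩ := hvf
    exact hef (by rw [h v b c he hf])

theorem isMaximalMatching_edgeSet {V : Type*} {G M : SimpleGraph V} :
    IsMaximalMatching G M.edgeSet ↔ IsMatching G M.edgeSet ∧
      ∀ a b, G.Adj a b → M.Covers a ∨ M.Covers b := by
  refine and_congr_right fun hM => ⟨fun h a b hab => ?_, fun h M' hM' hMM' => ?_⟩
  · by_contra! hcon
    have key : ∀ e ∈ M.edgeSet, ∀ v ∈ e, v ∉ s(a, b) := by
      intro e he v hv hvab
      obtain ⟨c, rfl⟩ := hv
      rcases Sym2.mem_iff.1 hvab with rfl | rfl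
      exacts [hcon.1 ⟨c, he⟩, hcon.2 ⟨c, he⟩]
    refine h (insert s(a, b) M.edgeSet) ⟨Set.insert_subset hab hM.1, ?_⟩
      (Set.ssubset_insert fun hmem => hcon.1 ⟨b, hmem⟩)
    rintro e (rfl | he) f (rfl | hf) hef v hve hvf
    · exact hef rfl
    · exact key f hf v hvf hve
    · exact key e he v hve hvf
    · exact hM.2 e he f hf hef v hve hvf
  · obtain ⟨e, he, heM⟩ := Set.exists_of_ssubset hMM'
    have key : ∀ a ∈ e, ¬M.Covers a := by
      rintro a ha ⟨c, hc⟩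
      exact hM'.2 e he s(a, c) (hMM'.1 hc) (fun hec => heM (hec ▸ hc)) a ha (Sym2.mem_mk_left _ _)
    induction e with
    | _ a b =>
      exact (h a b (hM'.1 he)).elim (key a (Sym2.mem_mk_left _ _)) (key b (Sym2.mem_mk_right _ _))

theorem isCompatibleForest_free {V : Type*} {G : SimpleGraph V} :
    IsCompatibleForest (fun _ => free) G ↔ G.IsAcyclic :=
  ⟨fun h => h.rooted.1, fun h => ⟨⟨h, by simp⟩, by simp⟩⟩

theorem isCompatibleMatching_free {V : Type*} {G M : SimpleGraph V} :
    IsCompatibleMatching (fun _ => free) (G, M) ↔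
      G.IsAcyclic ∧ IsMaximalMatching G M.edgeSet := by
  rw [isMaximalMatching_edgeSet, isMatching_edgeSet]
  constructor
  · rintro ⟨h1, h2, h3, -, -, -, h7⟩
    exact ⟨isCompatibleForest_free.1 h1, ⟨h2, h3⟩, fun a b hab => by simpa using h7 a b hab⟩
  · rintro ⟨h1, ⟨h2, h3⟩, h7⟩
    exact ⟨isCompatibleForest_free.2 h1, h2, h3, by simp, by simp, by simp,
      fun a b hab => by simpa using h7 a b hab⟩

theorem mN_eq_card (n : ℕ) :
    mN n = Nat.card {x // IsCompatibleMatching (fun _ : Fin n => free) x} := by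
  have hM : ∀ p : MMSpace n, (SimpleGraph.fromEdgeSet p.1.2).edgeSet = p.1.2 := fun p => by
    rw [SimpleGraph.edgeSet_fromEdgeSet, sdiff_eq_left, Set.disjoint_left]
    exact fun e he => SimpleGraph.not_isDiag_of_mem_edgeSet _ (p.2.2.1.1 he)
  exact Nat.card_congr
    { toFun := fun p => ⟨(p.1.1, SimpleGraph.fromEdgeSet p.1.2),
        isCompatibleMatching_free.2 ⟨p.2.1, by rw [hM p]; exact p.2.2⟩⟩
      invFun := fun x => ⟨(x.1.1, x.1.2.edgeSet), isCompatibleMatching_free.1 x.2⟩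
      left_inv := fun p => Subtype.ext (Prod.ext rfl (hM p))
      right_inv := fun x => Subtype.ext (Prod.ext rfl (SimpleGraph.fromEdgeSet_edgeSet _)) }

theorem mN_eq_matchingCoeff {s : ℝ} (hs : 0 < s) (n : ℕ) :
    (mN n : ℂ) = matchingCoeff s n 0 0 0 := by
  rw [mN_eq_card, card_isCompatibleMatching hs]
  simp [count]

theorem fN_eq_forestCoeff {s : ℝ} (hs : 0 < s) (n : ℕ) : (fN n : ℂ) = forestCoeff s n 0 := by
  have h := card_isCompatibleForest hs (fun _ : Fin n => free) (by simp)
  simp only [isCompatibleForest_free] at h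
  rw [fN, h]
  simp [count]

theorem stmt_8 :
    ∃ D β : ℝ, 0 < D ∧ 1 < β ∧
      Tendsto (fun n : ℕ => ((mN n : ℝ) / (fN n : ℝ)) / β ^ n) atTop (nhds D) :=
  exists_tendsto_ratio (fun _ hs => mN_eq_matchingCoeff hs) (fun _ hs => fN_eq_forestCoeff hs)
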